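/- Let t ≥ 2 and k ≥ 3 be integers, let m be an even integer with m ≥ 1.728·10^10·(t+k)^9, and let n be an integer with (t−1)(m−1) ≤ n−1 < t(m−1). If ⌊(n−1)/t⌋ < m−k, then R(C_m, B_n^{(k)}) = max{(t+k−1)(m−1)+1, n + k·⌊(n−1)/t⌋ + k}. -/

import Mathlib

/-- `G` contains a cycle of length `m`. -/
def HasCycleLen {V : Type*} (G : SimpleGraph V) (m : ℕ) : Prop :=
  ∃ (v : V) (c : G.Walk v v), c.IsCycle ∧ c.length = m

/-- `G` contains the book `B_n^{(k)}`: a clique on `k` vertices together with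
`n` further vertices each adjacent to all of them. -/
def HasBook {V : Type*} (G : SimpleGraph V) (k n : ℕ) : Prop :=
  ∃ S T : Finset V, S.card = k ∧ T.card = n ∧ Disjoint S T ∧
    (∀ u ∈ S, ∀ v ∈ S, u ≠ v → G.Adj u v) ∧
    (∀ u ∈ S, ∀ v ∈ T, G.Adj u v)

/-- Every simple graph on `N` vertices contains `C_m` or its complement contains
`B_n^{(k)}`. The Ramsey number `R(C_m, B_n^{(k)})` is the least such `N`. -/
def RamseyProp (m k n N : ℕ) : Prop :=
  ∀ G : SimpleGraph (Fin N), HasCycleLen G m ∨ HasBook Gᶜ k n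

-- A
section
open Classical

variable {V : Type*}

/-- path list from x to y -/
def PT (G : SimpleGraph V) (x y : V) (l : List V) : Prop :=
  l.Nodup ∧ l.IsChain G.Adj ∧ l.head? = some x ∧ l.getLast? = some y

/-- cycle list -/
def CL (G : SimpleGraph V) (l : List V) : Prop :=
  3 ≤ l.length ∧ ∃ x y, PT G x y l ∧ G.Adj y x

theorem PT.ne_nil {G : SimpleGraph V} {x y l} (h : PT G x y l) : l ≠ [] := by
  rintro rfl; simp [PT] at h

theorem PT.single (G : SimpleGraph V) (x : V) : PT G x x [x] := by simp [PT]

theorem PT.append {G : SimpleGraph V} {x y x' y' l l'} (h : PT G x y l) (h' : PT G x' y' l')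
    (ha : G.Adj y x') (hd : ∀ v ∈ l, v ∉ l') : PT G x y' (l ++ l') := by
  obtain ⟨h1, h2, h3, h4⟩ := h
  obtain ⟨g1, g2, g3, g4⟩ := h'
  refine ⟨List.nodup_append.2 ⟨h1, g1, fun a ha b hb hab => hd a ha (hab ▸ hb)⟩, ?_, ?_, ?_⟩
  · rw [List.isChain_append]
    refine ⟨h2, g2, ?_⟩
    intro a ha' b hb
    rw [h4] at ha'; rw [g3] at hb
    simp at ha' hb
    subst ha' hb; exact ha
  · simp [h3]
  · simp [g4]

theorem PT.reverse {G : SimpleGraph V} {x y l} (h : PT G x y l) : PT G y x l.reverse := by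
  obtain ⟨h1, h2, h3, h4⟩ := h
  refine ⟨by simpa, ?_, by simpa, by simpa⟩
  rw [List.isChain_reverse]
  exact h2.imp fun a b h => h.symm

theorem PT.cons {G : SimpleGraph V} {x y z l} (h : PT G x y l) (ha : G.Adj z x) (hd : z ∉ l) :
    PT G z y (z :: l) := 
  (PT.single G z).append h ha (by simpa using hd)

theorem PT.head_mem {G : SimpleGraph V} {x y l} (h : PT G x y l) : x ∈ l :=
  List.mem_of_mem_head? (by rw [h.2.2.1]; simp)

theorem PT.last_mem {G : SimpleGraph V} {x y l} (h : PT G x y l) : y ∈ l :=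
  List.mem_of_mem_getLast? (by rw [h.2.2.2]; simp)

theorem PT.split {G : SimpleGraph V} {x y A B} (h : PT G x y (A ++ B)) (hA : A ≠ []) (hB : B ≠ []) :
    ∃ u v, PT G x u A ∧ PT G v y B ∧ G.Adj u v ∧ ∀ v ∈ A, v ∉ B := by
  obtain ⟨h1, h2, h3, h4⟩ := h
  rw [List.isChain_append] at h2
  rw [List.nodup_append] at h1
  refine ⟨A.getLast hA, B.head hB, ⟨h1.1, h2.1, ?_, List.getLast?_eq_some_getLast hA⟩,
    ⟨h1.2.1, h2.2.1, List.head?_eq_some_head hB, ?_⟩, ?_, ?_⟩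
  · rwa [List.head?_append_of_ne_nil _ hA] at h3
  · rwa [List.getLast?_append_of_ne_nil _ hB] at h4
  · exact h2.2.2 _ (by simp [List.getLast?_eq_some_getLast hA]) _ (by simp [List.head?_eq_some_head hB])
  · intro v hv hv'; exact h1.2.2 v hv v hv' rfl

theorem PT.unique {G : SimpleGraph V} {x y x' y' l} (h : PT G x y l) (h' : PT G x' y' l) :
    x = x' ∧ y = y' := by
  have h1 := h.2.2.1; have h2 := h.2.2.2
  rw [h'.2.2.1] at h1; rw [h'.2.2.2] at h2
  simp at h1 h2
  exact ⟨h1.symm, h2.symm⟩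

theorem PT.length_one {G : SimpleGraph V} {x y l} (h : PT G x y l) (hx : x = y) : l = [x] := by
  subst hx
  obtain ⟨h1, h2, h3, h4⟩ := h
  match l with
  | [] => simp at h3
  | [a] => simp at h3; simp [h3]
  | a :: b :: l =>
    exfalso
    simp at h3
    subst h3
    rw [List.getLast?_cons_cons] at h4
    have := List.mem_of_mem_getLast? (l := b :: l) (a := a) (by rw [h4]; simp)
    simp at h1 this
    tauto

theorem path_edge_len {G : SimpleGraph V} {x y : V} (W : G.Walk x y) (this : W.IsPath)
    (hmem : s(x, y) ∈ W.edges) : W.length = 1 := by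
  cases W with
  | nil => simp at hmem
  | cons hh q =>
    rw [SimpleGraph.Walk.cons_isPath_iff] at this
    simp only [SimpleGraph.Walk.edges_cons, List.mem_cons] at hmem
    rcases hmem with hmem | hmem
    · simp only [Sym2.eq_iff, true_and] at hmem
      rcases hmem with hmem | hmem
      · subst hmem
        have := (SimpleGraph.Walk.isPath_iff_nil.1 this.1)
        simp [SimpleGraph.Walk.nil_iff_length_eq.1 this]
      · exact absurd hmem.1 hh.ne
    · exact absurd (SimpleGraph.Walk.fst_mem_support_of_mem_edges q hmem) this.2

theorem CL.hasCycleLen {G : SimpleGraph V} {l} (h : CL G l) : HasCycleLen G l.length := by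
  obtain ⟨h3, x, y, hp, ha⟩ := h
  have hne := hp.ne_nil
  let w := SimpleGraph.Walk.ofSupport l hne hp.2.1
  have hs : w.support = l := SimpleGraph.Walk.support_ofSupport ..
  have hl : w.length = l.length - 1 := SimpleGraph.Walk.length_ofSupport ..
  have hx : l.head hne = x := by
    have := hp.2.2.1; rw [List.head?_eq_some_head hne] at this; simpa using this
  have hy : l.getLast hne = y := by
    have := hp.2.2.2; rw [List.getLast?_eq_some_getLast hne] at this; simpa using this
  have hadj : G.Adj (l.getLast hne) (l.head hne) := by rw [hx, hy]; exact ha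
  have hpath : w.IsPath := by rw [SimpleGraph.Walk.isPath_def, hs]; exact hp.1
  refine ⟨_, SimpleGraph.Walk.cons hadj w, ?_, ?_⟩
  · rw [SimpleGraph.Walk.cons_isCycle_iff]
    refine ⟨hpath, fun hmem => ?_⟩
    have h2 : w.length = 1 := path_edge_len w hpath (by rwa [Sym2.eq_swap])
    omega
  · rw [SimpleGraph.Walk.length_cons, hl]; omega

theorem HasCycleLen.exists_CL {G : SimpleGraph V} {m} (h : HasCycleLen G m) :
    ∃ l, CL G l ∧ l.length = m := by
  obtain ⟨v, c, hc, rfl⟩ := h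
  cases c with
  | nil => simp at hc
  | cons hh q =>
    have h3 := hc.three_le_length
    rw [SimpleGraph.Walk.cons_isCycle_iff] at hc
    refine ⟨q.support, ⟨by simpa using h3, _, _, ⟨?_, q.isChain_adj_support, ?_, ?_⟩, hh⟩, by simp⟩
    · exact (SimpleGraph.Walk.isPath_def _).1 hc.1
    · rw [List.head?_eq_some_head q.support_ne_nil]; simp
    · rw [List.getLast?_eq_some_getLast q.support_ne_nil]; simp

theorem CL.rotate {G : SimpleGraph V} {A B} (h : CL G (A ++ B)) : CL G (B ++ A) := by
  by_cases hA : A = []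
  · subst hA; simpa using h
  by_cases hB : B = []
  · subst hB; simpa using h
  obtain ⟨h3, x, y, hp, ha⟩ := h
  obtain ⟨u, v, h1, h2, h4, h5⟩ := hp.split hA hB
  refine ⟨by simp at h3 ⊢; omega, v, u, h2.append h1 ha ?_, h4⟩
  intro w hw hw'; exact h5 w hw' hw

theorem CL.mono {G H : SimpleGraph V} (hGH : G ≤ H) {l} (h : CL G l) : CL H l := by
  obtain ⟨h3, x, y, hp, ha⟩ := h
  exact ⟨h3, x, y, ⟨hp.1, hp.2.1.imp fun a b h => hGH h, hp.2.2⟩, hGH ha⟩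

/-- immediate successor -/
def Nx (l : List V) (u v : V) : Prop := ∃ A D, l = A ++ u :: v :: D

theorem Nx.mem_left {l : List V} {u v} (h : Nx l u v) : u ∈ l := by
  obtain ⟨A, D, rfl⟩ := h; simp
theorem Nx.mem_right {l : List V} {u v} (h : Nx l u v) : v ∈ l := by
  obtain ⟨A, D, rfl⟩ := h; simp

theorem Nx.exists {G : SimpleGraph V} {x y l} (h : PT G x y l) {u} (hu : u ∈ l) (huy : u ≠ y) :
    ∃ v, Nx l u v := by
  obtain ⟨A, B, rfl⟩ := List.append_of_mem hu
  match B with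
  | [] => have := h.2.2.2; simp at this; exact absurd this huy
  | v :: D => exact ⟨v, A, D, rfl⟩

theorem append_cancel_nodup {A D A' D' : List V} {u} (hl : (A ++ u :: D).Nodup)
    (h : A ++ u :: D = A' ++ u :: D') : A = A' ∧ D = D' := by
  rw [List.append_eq_append_iff] at h
  rcases h with ⟨C, h1, h2⟩ | ⟨C, h1, h2⟩
  · cases C with
    | nil => simp at h1 h2; exact ⟨h1.symm, h2⟩
    | cons c C =>
      simp at h2; subst h1; obtain ⟨rfl, h2⟩ := h2
      subst h2
      simp [List.nodup_append] at hl
  · cases C with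
    | nil => simp at h1 h2; exact ⟨h1, h2.symm⟩
    | cons c C =>
      simp at h2; subst h1; obtain ⟨rfl, h2⟩ := h2
      subst h2
      simp [List.nodup_append] at hl

theorem Nx.inj {l : List V} (hl : l.Nodup) {u u' v} (h : Nx l u v) (h' : Nx l u' v) : u = u' := by
  obtain ⟨A, D, rfl⟩ := h
  obtain ⟨A', D', h⟩ := h'
  have := append_cancel_nodup (A := A ++ [u]) (A' := A' ++ [u']) (u := v) (D := D) (D' := D')
    (by simpa using hl) (by simpa using h)
  have := this.1
  simpa using (List.append_inj' this rfl).2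

theorem Nx.adj {G : SimpleGraph V} {x y l} (h : PT G x y l) {u v} (hx : Nx l u v) : G.Adj u v := by
  obtain ⟨A, D, rfl⟩ := hx
  have := h.2.1
  rw [List.isChain_append] at this
  exact (List.isChain_cons_cons.1 this.2.1).1

theorem Nx.ne_last {G : SimpleGraph V} {x y l} (h : PT G x y l) {u v} (hx : Nx l u v) : u ≠ y := by
  rintro rfl
  obtain ⟨A, D, rfl⟩ := hx
  have h1 := h.2.2.2
  have h2 := h.1
  simp at h1
  have h3 := List.mem_of_mem_getLast? (l := v :: D) (a := u) (by simp [h1])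
  simp [List.nodup_append] at h2 h3
  tauto

theorem Nx.split3_aux {G : SimpleGraph V} {x y l} (h : PT G x y l) {u u' v v'}
    (h1 : Nx l u u') (h2 : Nx l v v') (huv : u ≠ v) :
    (∃ A B D, l = A ++ B ++ D ∧ PT G x u A ∧ PT G u' v B ∧ PT G v' y D) ∨
    (∃ A B D, l = A ++ B ++ D ∧ PT G x v A ∧ PT G v' u B ∧ PT G u' y D) := by
  have key : ∀ A1 D1 C D2 : List V, ∀ u u' v v' : V, l = A1 ++ u :: u' :: D1 → u ≠ v →
     C ++ v :: v' :: D2 = u :: u' :: D1 → 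
     (∃ A B D, l = A ++ B ++ D ∧ PT G x u A ∧ PT G u' v B ∧ PT G v' y D) := by
    intro A1 D1 C D2 u u' v v' hl huv hC
    cases C with
    | nil => simp at hC; exact absurd hC.1.symm huv
    | cons c C' =>
      simp at hC
      obtain ⟨rfl, hC⟩ := hC
      refine ⟨A1 ++ [c], C' ++ [v], v' :: D2, by simp [hl, hC], ?_⟩
      have hl' : l = (A1 ++ [c]) ++ ((C' ++ [v]) ++ v' :: D2) := by simp [hl, hC]
      rw [hl'] at h
      obtain ⟨a, b, h1, h2, -, -⟩ := h.split (by simp) (by simp)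
      obtain ⟨a', b', h3, h4, -, -⟩ := h2.split (by simp) (by simp)
      have e1 : a = c := by have := h1.2.2.2; simp at this; exact this.symm
      have e2 : a' = v := by have := h3.2.2.2; simp at this; exact this.symm
      have e3 : b' = v' := by have := h4.2.2.1; simp at this; exact this.symm
      have e4 : b = u' := by
        have := h2.2.2.1
        have e : (C' ++ [v] ++ v' :: D2) = u' :: D1 := by simpa using hC
        rw [e] at this; simpa using this.symm
      subst e1 e2 e3 e4
      exact ⟨h1, h3, h4⟩
  obtain ⟨A1, D1, e1⟩ := h1
  obtain ⟨A2, D2, e2⟩ := h2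
  have e := e1.symm.trans e2
  rw [List.append_eq_append_iff] at e
  rcases e with ⟨C, h1, h2⟩ | ⟨C, h1, h2⟩
  · left; exact key A1 D1 C D2 u u' v v' e1 huv h2.symm
  · right; exact key A2 D2 C D1 v v' u u' e2 huv.symm h2.symm

/-- surgery with two connecting vertices/paths -/
theorem PT.surgery2 {G : SimpleGraph V} {x y l} (h : PT G x y l) {u u' v v'}
    (h1 : Nx l u u') (h2 : Nx l v v') (huv : u ≠ v) {o o' : V} (ho : o ∉ l) (ho' : o' ∉ l)
    (hoo : o ≠ o') (a1 : G.Adj o u) (a2 : G.Adj o v) (a3 : G.Adj o' u') (a4 : G.Adj o' v') :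
    ∃ l', PT G x y l' ∧ l'.Perm (o :: o' :: l) := by
  have key : ∀ u u' v v' : V, (∃ A B D, l = A ++ B ++ D ∧ PT G x u A ∧ PT G u' v B ∧ PT G v' y D) →
      G.Adj o u → G.Adj o v → G.Adj o' u' → G.Adj o' v' → 
      ∃ l', PT G x y l' ∧ l'.Perm (o :: o' :: l) := by
    rintro u u' v v' ⟨A, B, D, rfl, hA, hB, hD⟩ a1 a2 a3 a4
    simp at ho ho'
    have hnd := h.1
    simp [List.nodup_append] at hnd
    refine ⟨A ++ (o :: (B.reverse ++ (o' :: D))), ?_, ?_⟩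
    · refine hA.append (PT.cons (hB.reverse.append (PT.cons hD a4 (by tauto)) a3.symm ?_) a2 ?_) a1.symm ?_
      · intro w hw hw'
        simp at hw hw'
        rcases hw' with rfl | hw'
        · tauto
        · exact hnd.2.1.2.2 w hw w hw' rfl
      · simp; tauto
      · intro w hw hw'
        simp at hw'
        rcases hw' with rfl | hw' | rfl | hw'
        · tauto
        · exact hnd.2.2 w hw w (Or.inl hw') rfl
        · tauto
        · exact hnd.2.2 w hw w (Or.inr hw') rfl
    · rw [List.perm_iff_count]
      intro a
      simp [List.count_cons]; omega
  rcases Nx.split3_aux h h1 h2 huv with hh | hh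
  · exact key u u' v v' hh a1 a2 a3 a4
  · exact key v v' u u' hh a2 a1 a4 a3

/-- insert a path `d` from p to q -/
theorem PT.surgery1 {G : SimpleGraph V} {x y l} (h : PT G x y l) {u u' v v'}
    (h1 : Nx l u u') (h2 : Nx l v v') (huv : u ≠ v) (a0 : G.Adj u' v') {p q d} (hd : PT G p q d)
    (hdl : ∀ w ∈ d, w ∉ l) (a1 : G.Adj u p) (a2 : G.Adj q v)  :
    ∃ l', PT G x y l' ∧ l'.Perm (d ++ l) := by
  have key : ∀ u u' v v' p q d, (∃ A B D, l = A ++ B ++ D ∧ PT G x u A ∧ PT G u' v B ∧ PT G v' y D) →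
      G.Adj u' v' → PT G p q d → (∀ w ∈ d, w ∉ l) → G.Adj u p → G.Adj q v → 
      ∃ l', PT G x y l' ∧ l'.Perm (d ++ l) := by
    rintro u u' v v' p q d ⟨A, B, D, rfl, hA, hB, hD⟩ a0 hd hdl a1 a2
    have hnd := h.1
    simp [List.nodup_append] at hnd
    simp at hdl
    refine ⟨A ++ (d ++ (B.reverse ++ D)), ?_, ?_⟩
    · refine hA.append (hd.append (hB.reverse.append hD a0 ?_) a2 ?_) a1 ?_
      · intro w hw hw'
        simp at hw hw'
        exact hnd.2.1.2.2 w hw w hw' rfl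
      · intro w hw; simp; have := hdl w hw; tauto
      · intro w hw hw'
        simp at hw'
        rcases hw' with hw' | hw' | hw'
        · exact (hdl w hw').1 hw
        · exact hnd.2.2 w hw w (Or.inl hw') rfl
        · exact hnd.2.2 w hw w (Or.inr hw') rfl
    · rw [List.perm_iff_count]
      intro a
      simp; omega
  rcases Nx.split3_aux h h1 h2 huv with hh | hh
  · exact key u u' v v' p q d hh a0 hd hdl a1 a2
  · exact key v v' u u' q p d.reverse hh a0.symm hd.reverse (by simpa using hdl) a2.symm a1.symm
      |>.imp fun l' h => ⟨h.1, h.2.trans (List.Perm.append_right _ (List.reverse_perm d))⟩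

theorem PT.insert {G : SimpleGraph V} {x y l} (h : PT G x y l) {u u' v v' z}
    (h1 : Nx l u u') (h2 : Nx l v v') (huv : u ≠ v) (a0 : G.Adj u' v') (hz : z ∉ l)
    (a1 : G.Adj z u) (a2 : G.Adj z v)  :
    ∃ l', PT G x y l' ∧ l'.Perm (z :: l) :=
  h.surgery1 h1 h2 huv a0 (PT.single G z) (by simpa using hz) a1.symm a2

/-- successor function -/
theorem PT.exists_succ {G : SimpleGraph V} {x y l} (h : PT G x y l) :
    ∃ s : V → V, (∀ u ∈ l, u ≠ y → Nx l u (s u)) ∧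
      (∀ u ∈ l, u ≠ y → ∀ v ∈ l, v ≠ y → s u = s v → u = v) := by
  have : ∀ u, ∃ v, u ∈ l → u ≠ y → Nx l u v := by
    intro u
    by_cases hu : u ∈ l ∧ u ≠ y
    · obtain ⟨v, hv⟩ := Nx.exists h hu.1 hu.2
      exact ⟨v, fun _ _ => hv⟩
    · exact ⟨u, fun h1 h2 => absurd ⟨h1, h2⟩ hu⟩
  choose s hs using this
  refine ⟨s, hs, fun u hu huy v hv hvy e => ?_⟩
  exact Nx.inj h.1 (hs u hu huy) (e ▸ hs v hv hvy)

end

-- B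
section
open Classical Finset

variable {V : Type*}

theorem exists_max_nat {α : Type*} (f : α → ℕ) (P : α → Prop) (b : ℕ) (h0 : ∃ a, P a)
    (hb : ∀ a, P a → f a ≤ b) : ∃ a, P a ∧ ∀ a', P a' → f a' ≤ f a := by
  by_contra hcon
  push Not at hcon
  have : ∀ n : ℕ, ∃ a, P a ∧ n ≤ f a := by
    intro n
    induction n with
    | zero => obtain ⟨a, ha⟩ := h0; exact ⟨a, ha, Nat.zero_le _⟩
    | succ n ih =>
      obtain ⟨a, ha, hn⟩ := ih
      obtain ⟨a', ha', hlt⟩ := hcon a ha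
      exact ⟨a', ha', by omega⟩
  obtain ⟨a, ha, hn⟩ := this (b + 1)
  have := hb a ha
  omega

theorem list_last_sat (l : List V) (P : V → Prop) (h : ∃ x ∈ l, P x) :
    ∃ A w B, l = A ++ w :: B ∧ P w ∧ ∀ b ∈ B, ¬ P b := by
  induction l with
  | nil => simp at h
  | cons a l ih =>
    by_cases h' : ∃ x ∈ l, P x
    · obtain ⟨A, w, B, rfl, h1, h2⟩ := ih h'
      exact ⟨a :: A, w, B, rfl, h1, h2⟩
    · push Not at h'
      obtain ⟨x, hx, hP⟩ := h
      simp at hx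
      rcases hx with rfl | hx
      · exact ⟨[], x, l, rfl, hP, h'⟩
      · exact absurd hP (h' x hx)

def Ind (G : SimpleGraph V) (S : Finset V) : Prop := ∀ u ∈ S, ∀ v ∈ S, ¬ G.Adj u v

theorem Ind.subset {G : SimpleGraph V} {S T : Finset V} (h : Ind G S) (hT : T ⊆ S) : Ind G T :=
  fun u hu v hv => h u (hT hu) v (hT hv)

theorem nodup_length_le {l : List V} (hl : l.Nodup) {U : Finset V} (h : ∀ v ∈ l, v ∈ U) :
    l.length ≤ U.card := by
  rw [← List.toFinset_card_of_nodup hl]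
  exact card_le_card fun v hv => h v (by simpa using hv)

/-- Lemma P -/
theorem lemP (G : SimpleGraph V) (U : Finset V) (hU : U.Nonempty) (d : ℕ) (hd : 2 ≤ d)
    (hno : ∀ l, CL G l → (∀ v ∈ l, v ∈ U) → l.length ≤ d) :
    ∃ v ∈ U, (U.filter (G.Adj v)).card ≤ d - 1 := by
  obtain ⟨l, ⟨hlU, x, y, hp⟩, hmax⟩ := exists_max_nat (fun l : List V => l.length)
    (fun l => (∀ v ∈ l, v ∈ U) ∧ ∃ x y, PT G x y l) U.card
    (by obtain ⟨v, hv⟩ := hU; exact ⟨[v], by simpa using hv, v, v, PT.single G v⟩)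
    (by rintro l ⟨h1, x, y, h2⟩; exact nodup_length_le h2.1 h1)
  refine ⟨x, hlU x hp.head_mem, ?_⟩
  have hin : ∀ w ∈ U, G.Adj x w → w ∈ l := by
    intro w hw ha
    by_contra hwl
    have := hmax (w :: l) ⟨by simpa using ⟨hw, hlU⟩, w, y, hp.cons ha.symm hwl⟩
    simp at this
  by_cases hex : ∃ w ∈ l, G.Adj x w
  swap
  · push Not at hex
    have : U.filter (G.Adj x) = ∅ := by
      ext w; simp only [mem_filter, notMem_empty, iff_false, not_and]
      intro hw ha; exact hex w (hin w hw ha) ha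
    rw [this]; simp
  obtain ⟨A, w, B, rfl, hw, hB⟩ := list_last_sat l _ hex
  have hp' : PT G x w (A ++ [w]) := by
    by_cases hBn : B = []
    · subst hBn
      have : w = y := by have := hp.2.2.2; simpa using this
      subst this; exact hp
    · have e : A ++ w :: B = (A ++ [w]) ++ B := by simp
      rw [e] at hp
      obtain ⟨u, v, h1, h2, -⟩ := hp.split (by simp) hBn
      have : u = w := by have := h1.2.2.2; simp at this; exact this.symm
      exact this ▸ h1
  have hsub : U.filter (G.Adj x) ⊆ (A ++ [w]).toFinset.erase x := by
    intro v hv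
    simp only [mem_filter] at hv
    have h1 := hin v hv.1 hv.2
    simp at h1 ⊢
    refine ⟨hv.2.ne', ?_⟩
    rcases h1 with h1 | h1 | h1
    · exact Or.inr h1
    · exact Or.inl h1
    · exact absurd hv.2 (hB v h1)
  have hcard := card_le_card hsub
  rw [card_erase_of_mem (List.mem_toFinset.2 hp'.head_mem), List.toFinset_card_of_nodup hp'.1] at hcard
  by_cases h3 : 3 ≤ (A ++ [w]).length
  · have := hno (A ++ [w]) ⟨h3, x, w, hp', hw.symm⟩ (fun v hv => hlU v (by simp at hv ⊢; tauto))
    omega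
  · omega

theorem greedyInd (G : SimpleGraph V) (d : ℕ) (U : Finset V)
    (h : ∀ U' ⊆ U, U'.Nonempty → ∃ v ∈ U', (U'.filter (G.Adj v)).card ≤ d) :
    ∃ I ⊆ U, Ind G I ∧ U.card ≤ (d + 1) * I.card := by
  induction U using Finset.strongInduction with
  | H U ih =>
    by_cases hU : U.Nonempty
    swap
    · rw [not_nonempty_iff_eq_empty] at hU; subst hU
      exact ⟨∅, by simp, by simp [Ind], by simp⟩
    obtain ⟨v, hv, hd⟩ := h U (Subset.refl _) hU
    have hsub : (U.filter fun w => w ≠ v ∧ ¬ G.Adj v w) ⊂ U := by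
      refine ⟨filter_subset _ _, fun hh => ?_⟩
      have := hh hv; simp at this
    obtain ⟨I, hI, hind, hc⟩ := ih _ hsub fun U' hU' => h U' (hU'.trans hsub.1)
    have hvI : v ∉ I := fun hh => by have := hI hh; simp at this
    refine ⟨insert v I, ?_, ?_, ?_⟩
    · intro w hw
      rcases mem_insert.1 hw with rfl | hw
      · exact hv
      · exact hsub.1 (hI hw)
    · intro a ha b hb
      rcases mem_insert.1 ha with ha | ha <;> rcases mem_insert.1 hb with hb | hb
      · rw [ha, hb]; simp
      · have := hI hb; simp at this; rw [ha]; exact this.2.2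
      · have := hI ha; simp at this; rw [hb]; exact fun hh => this.2.2 hh.symm
      · exact hind a ha b hb
    · rw [card_insert_of_notMem hvI]
      have : U ⊆ insert v (U.filter (G.Adj v)) ∪ (U.filter fun w => w ≠ v ∧ ¬ G.Adj v w) := by
        intro w hw; simp [hw]; tauto
      have := (card_le_card this).trans (card_union_le _ _)
      have h2 := card_insert_le v (U.filter (G.Adj v))
      nlinarith

theorem forest_edges (G : SimpleGraph V) (U : Finset V) (hU : U.Nonempty)
    (hno : ∀ l, CL G l → (∀ v ∈ l, v ∈ U) → False) :
    ∑ v ∈ U, (U.filter (G.Adj v)).card + 2 ≤ 2 * U.card := by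
  induction U using Finset.strongInduction with
  | H U ih =>
    obtain ⟨v, hv, hd⟩ := lemP G U hU 2 le_rfl (fun l h h' => (hno l h h').elim)
    by_cases hne : (U.erase v).Nonempty
    · have := ih (U.erase v) (erase_ssubset hv) hne
        (fun l h h' => hno l h fun w hw => mem_of_mem_erase (h' w hw))
      have hc := card_erase_add_one hv
      have hs : ∑ w ∈ U, (U.filter (G.Adj w)).card =
          ∑ w ∈ U.erase v, (U.filter (G.Adj w)).card + (U.filter (G.Adj v)).card := by
        rw [sum_erase_add _ _ hv]
      have hs2 : ∀ w ∈ U.erase v, (U.filter (G.Adj w)).card =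
          ((U.erase v).filter (G.Adj w)).card + if G.Adj w v then 1 else 0 := by
        intro w hw
        rw [filter_erase]
        split_ifs with hh
        · rw [card_erase_add_one]; simp [hv, hh]
        · rw [erase_eq_of_notMem]; · rfl
          simp [hh]
      rw [sum_congr rfl hs2, sum_add_distrib, ← card_filter] at hs
      have : ((U.erase v).filter (fun w => G.Adj w v)).card ≤ (U.filter (G.Adj v)).card := by
        apply card_le_card; intro w hw
        simp at hw ⊢; exact ⟨hw.1.2, hw.2.symm⟩
      omega
    · have : U = {v} := by
        rw [not_nonempty_iff_eq_empty] at hne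
        rw [← insert_erase hv, hne]; rfl
      subst this
      simp [filter_singleton]

end

-- C
section
open Classical Finset

variable {V : Type*}

theorem doubleCount (G : SimpleGraph V) (R O : Finset V) (r c : ℕ)
    (h : ∀ u ∈ R, r ≤ (O.filter (G.Adj u)).card) (hc : c * O.card < R.card * r) :
    ∃ o ∈ O, c < (R.filter (G.Adj o)).card := by
  by_contra hcon
  push Not at hcon
  have h1 : ∑ u ∈ R, (O.filter (G.Adj u)).card = ∑ o ∈ O, (R.filter (fun u => G.Adj u o)).card :=
    sum_card_bipartiteAbove_eq_sum_card_bipartiteBelow G.Adj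
  have h2 : R.card * r ≤ ∑ u ∈ R, (O.filter (G.Adj u)).card := by
    rw [← smul_eq_mul]; exact card_nsmul_le_sum _ _ _ h
  have h3 : ∑ o ∈ O, (R.filter (fun u => G.Adj u o)).card ≤ O.card * c := by
    rw [← smul_eq_mul]; refine sum_le_card_nsmul _ _ _ fun o ho => ?_
    have := hcon o ho
    simpa [G.adj_comm] using this
  nlinarith

theorem Nx.uniq {l : List V} (hl : l.Nodup) {u v v'} (h : Nx l u v) (h' : Nx l u v') : v = v' := by
  obtain ⟨A, D, rfl⟩ := h
  obtain ⟨A', D', h⟩ := h'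
  have := (append_cancel_nodup hl h).2
  simp at this; exact this.1

theorem Nx.append_left {l l' : List V} {u v} (h : Nx l u v) : Nx (l ++ l') u v := by
  obtain ⟨A, D, rfl⟩ := h; exact ⟨A, D ++ l', by simp⟩
theorem Nx.append_right {l l' : List V} {u v} (h : Nx l' u v) : Nx (l ++ l') u v := by
  obtain ⟨A, D, rfl⟩ := h; exact ⟨l ++ A, D, by simp⟩

theorem list_split_count (l : List V) (hl : l.Nodup) (R : Finset V) (hR : ∀ v ∈ R, v ∈ l) (c : ℕ)
    (hc : c ≤ R.card) : ∃ A B, l = A ++ B ∧ (R.filter (· ∈ A)).card = c := by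
  induction l using List.reverseRecOn generalizing R with
  | nil =>
    have : R = ∅ := by ext v; simp; intro hv; simpa using hR v hv
    subst this; exact ⟨[], [], rfl, by simp at hc; simp [hc]⟩
  | append_singleton l a ih =>
    by_cases hcR : c = R.card
    · refine ⟨l ++ [a], [], by simp, ?_⟩
      rw [filter_true_of_mem hR, hcR]
    · have hal : a ∉ l := by simp [List.nodup_append] at hl; intro h; exact (hl.2 a h) rfl
      obtain ⟨A, B, rfl, hcard⟩ := ih (by simp [List.nodup_append] at hl ⊢; exact hl.1) (R.erase a)
        (by intro v hv
            simp at hv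
            have := hR v hv.2
            simp at this; tauto)
        (by have := pred_card_le_card_erase (s := R) (a := a); omega)
      refine ⟨A, B ++ [a], by simp, ?_⟩
      rw [← hcard]; congr 1; ext v; simp
      intro hv _ hva; subst hva; simp at hal; tauto

/-- find an insertion of a new vertex of `O` in a path -/
theorem halfInsert (G : SimpleGraph V) {x y l} (h : PT G x y l) (R O : Finset V) (r k : ℕ)
    (s : V → V) (hs : ∀ u ∈ R, Nx l u (s u))
    (hO : ∀ o ∈ O, o ∉ l) (hr : ∀ u ∈ R, r ≤ (O.filter (G.Adj u)).card)
    (hdep : ∀ R' ⊆ R, k ≤ (R'.image s).card → ¬ Ind G (R'.image s))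
    (hc : k * O.card < R.card * r) :
    ∃ o ∈ O, ∃ l', PT G x y l' ∧ l'.Perm (o :: l) := by
  obtain ⟨o, ho, hlt⟩ := doubleCount G R O r k hr hc
  have hinj : Set.InjOn s (R.filter (G.Adj o)) := by
    intro u hu v hv e
    simp at hu hv
    exact Nx.inj h.1 (hs u hu.1) (e ▸ hs v hv.1)
  have := hdep (R.filter (G.Adj o)) (filter_subset _ _) (by rw [card_image_of_injOn hinj]; omega)
  unfold Ind at this
  push Not at this
  obtain ⟨a, ha, b, hb, hab⟩ := this
  obtain ⟨u, hu, rfl⟩ := mem_image.1 ha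
  obtain ⟨v, hv, rfl⟩ := mem_image.1 hb
  simp at hu hv
  have huv : u ≠ v := by rintro rfl; exact G.loopless.irrefl _ hab
  obtain ⟨l', h1, h2⟩ := h.insert (hs u hu.1) (hs v hv.1) huv hab (hO o ho) hu.2 hv.2
  exact ⟨o, ho, l', h1, h2⟩

variable [Fintype V]

/-- closed neighbourhood of a set -/
noncomputable def cn (G : SimpleGraph V) (S : Finset V) : Finset V :=
  univ.filter fun v => ∃ s ∈ S, v = s ∨ G.Adj s v

def BC (G : SimpleGraph V) (k K : ℕ) : Prop := ∀ S, Ind G S → S.card = k → K ≤ (cn G S).card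

theorem BC.few {G : SimpleGraph V} {k K : ℕ} (hB : BC G k K) (L : Finset V) (r : ℕ)
    (hK : L.card + k * r < K) (S : Finset V) (hS : S ⊆ L) (hI : Ind G S)
    (hr : ∀ u ∈ S, ((univ \ L).filter (G.Adj u)).card < r) : S.card < k := by
  by_contra hcon
  push Not at hcon
  obtain ⟨S', hS', hc⟩ := exists_subset_card_eq hcon
  have h1 := hB S' (hI.subset hS') hc
  have h2 : cn G S' ⊆ L ∪ S'.biUnion fun u => (univ \ L).filter (G.Adj u) := by
    intro v hv
    simp [cn] at hv ⊢
    obtain ⟨s, hs, rfl | ha⟩ := hv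
    · exact Or.inl (hS (hS' hs))
    · by_cases hv : v ∈ L
      · exact Or.inl hv
      · exact Or.inr ⟨s, hs, hv, ha⟩
  have h3 := (card_le_card h2).trans (card_union_le _ _)
  have h4 : (S'.biUnion fun u => (univ \ L).filter (G.Adj u)).card ≤ S'.card * r :=
    card_biUnion_le_card_mul _ _ _ fun u hu => (hr u (hS' hu)).le
  rw [hc] at h4
  omega

theorem growth (G : SimpleGraph V) (p k m K r0 : ℕ) (hp : 5 ≤ p) (hkp : k ≤ p)
    (hN : Fintype.card V ≤ p * m) (hm : 200 * p ≤ m)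
    (h1 : 4 * r0 ≤ m) (h2 : m < 4 * r0 + 4) (hB : BC G k K) (hK : m + k * r0 < K)
    (l : List V) (hl : CL G l) (hlm : l.length ≤ m) (A : Finset V) (hAl : ∀ v ∈ A, v ∈ l)
    (hA : Ind G A) (hAc : 40 * p ^ 2 + k ≤ A.card) :
    ∃ l', CL G l' ∧ l'.length = l.length + 2 ∧ ∀ v ∈ l, v ∈ l' := by
  obtain ⟨hl3, x, y, hpt, hyx⟩ := hl
  set L := l.toFinset with hL
  have hLc : L.card = l.length := List.toFinset_card_of_nodup hpt.1
  set O := univ \ L with hO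
  have hOl : ∀ o ∈ O, o ∉ l := by intro o ho; simpa [hO, hL] using ho
  have hOc : O.card ≤ p * m := (card_le_univ _).trans hN
  have few : ∀ S ⊆ L, Ind G S → (∀ u ∈ S, (O.filter (G.Adj u)).card < r0) → S.card < k :=
    fun S hS hI hr => hB.few L r0 (by omega) S hS hI hr
  obtain ⟨s, hs, hsinj⟩ := hpt.exists_succ
  set R := A.filter (fun u => u ≠ y ∧ r0 ≤ (O.filter (G.Adj u)).card) with hR
  have hRc : 40 * p ^ 2 ≤ R.card := by
    have hf := few (A.filter fun u => (O.filter (G.Adj u)).card < r0)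
      (fun u hu => by simp at hu; simpa [hL] using hAl u hu.1) (hA.subset (filter_subset _ _))
      (fun u hu => by simp at hu; exact hu.2)
    have hsub : A ⊆ (A.filter fun u => (O.filter (G.Adj u)).card < r0) ∪ insert y R := by
      intro u hu
      simp [hR, hu]
      by_cases h : u = y
      · simp [h]
      · simp only [h, false_or, not_false_eq_true, true_and]; exact lt_or_ge _ _
    have := (card_le_card hsub).trans (card_union_le _ _)
    have h3 := card_insert_le y R
    omega
  have hRl : ∀ u ∈ R, u ∈ l ∧ u ≠ y := fun u hu => by
    simp [hR] at hu; exact ⟨hAl u hu.1, hu.2.1⟩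
  have hsR : ∀ u ∈ R, Nx l u (s u) := fun u hu => hs u (hRl u hu).1 (hRl u hu).2
  have hrR : ∀ u ∈ R, r0 ≤ (O.filter (G.Adj u)).card := fun u hu => by
    simp only [hR, mem_filter] at hu; exact hu.2.2
  have hinj : ∀ R' ⊆ R, Set.InjOn s R' := by
    intro R' hR' u hu v hv e
    exact Nx.inj hpt.1 (hsR u (hR' hu)) (e ▸ hsR v (hR' hv))
  have hclose : ∀ o o' l', o ∉ l → o' ∉ l → PT G x y l' → l'.Perm (o :: o' :: l) →
      ∃ l', CL G l' ∧ l'.length = l.length + 2 ∧ ∀ v ∈ l, v ∈ l' := by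
    intro o o' l' _ _ hp' hperm
    have hlen := hperm.length_eq
    simp at hlen
    refine ⟨l', ⟨by omega, x, y, hp', hyx⟩, by omega, fun v hv => hperm.symm.subset (by simp [hv])⟩
  have hm4 : m ≤ 4 * r0 + 3 := by omega
  set R1 := R.filter (fun u => r0 ≤ (O.filter (G.Adj (s u))).card) with hR1
  set R2 := R.filter (fun u => ¬ r0 ≤ (O.filter (G.Adj (s u))).card) with hR2
  have hR12 : R1.card + R2.card = R.card := card_filter_add_card_filter_not _
  by_cases hcase : 20 * p ^ 2 ≤ R1.card
  · -- case RR
    have hR1R : R1 ⊆ R := filter_subset _ _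
    obtain ⟨o, ho, hlt⟩ := doubleCount G R1 O r0 (4 * p) (fun u hu => hrR u (hR1R hu)) (by
      have : 4 * p * O.card ≤ 4 * p * (p * m) := Nat.mul_le_mul_left _ hOc
      have h5 : 20 * p ^ 2 * r0 ≤ R1.card * r0 := Nat.mul_le_mul_right _ hcase
      have h6 : 20 * p ^ 2 * r0 > 4 * p * (p * m) := by
        have : 5 * r0 > m := by omega
        have : p ^ 2 * (5 * r0) > p ^ 2 * m := Nat.mul_lt_mul_of_pos_left this (by positivity)
        nlinarith
      omega)
    set R' := R1.filter (G.Adj o) with hR'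
    have hR'R : R' ⊆ R := (filter_subset _ _).trans hR1R
    obtain ⟨o', ho', hlt'⟩ := doubleCount G (R'.image s) (O.erase o) (r0 - 1) 1 (by
      intro w hw
      obtain ⟨u, hu, rfl⟩ := mem_image.1 hw
      have : r0 ≤ (O.filter (G.Adj (s u))).card := by
        have := (filter_subset _ _) hu
        simp only [hR1, mem_filter] at this; exact this.2
      have h5 := pred_card_le_card_erase (s := O.filter (G.Adj (s u))) (a := o)
      rw [filter_erase]; omega) (by
      rw [card_image_of_injOn (hinj R' hR'R)]
      have : (O.erase o).card ≤ O.card := card_le_card (erase_subset _ _)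
      have h5 : (4 * p + 1) * (r0 - 1) ≤ R'.card * (r0 - 1) := Nat.mul_le_mul_right _ hlt
      have h6 : p * m < (4 * p + 1) * (r0 - 1) := by
        obtain ⟨q, rfl⟩ : ∃ q, r0 = q + 1 := ⟨r0 - 1, by omega⟩
        simp
        have : p * m ≤ p * (4 * q + 7) := Nat.mul_le_mul_left _ (by omega)
        nlinarith
      omega)
    obtain ⟨a, ha, b, hb, hab⟩ := one_lt_card.1 hlt'
    simp only [mem_filter] at ha hb
    obtain ⟨u, hu, rfl⟩ := mem_image.1 ha.1
    obtain ⟨v, hv, rfl⟩ := mem_image.1 hb.1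
    have huv : u ≠ v := by rintro rfl; exact hab rfl
    simp only [mem_erase] at ho'
    obtain ⟨l', hp', hperm⟩ := hpt.surgery2 (hsR u (hR'R hu)) (hsR v (hR'R hv)) huv (hOl o ho)
      (hOl o' ho'.2) (Ne.symm ho'.1) (mem_filter.1 hu).2 (mem_filter.1 hv).2 ha.2 hb.2
    exact hclose o o' l' (hOl o ho) (hOl o' ho'.2) hp' hperm
  · -- case RL
    have hR2c : 20 * p ^ 2 ≤ R2.card := by omega
    have hR2R : R2 ⊆ R := filter_subset _ _
    obtain ⟨l1, l2, hll, hcard⟩ := list_split_count l hpt.1 R2 (fun v hv => (hRl v (hR2R hv)).1)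
      (10 * p ^ 2) (by omega)
    have hp2 : 25 ≤ p ^ 2 := by nlinarith
    have hcard2 : 10 * p ^ 2 ≤ (R2.filter (· ∈ l2)).card := by
      have : R2 ⊆ (R2.filter (· ∈ l1)) ∪ (R2.filter (· ∈ l2)) := by
        intro u hu
        have := (hRl u (hR2R hu)).1
        rw [hll] at this
        simp at this
        simp [hu, this]
      have := (card_le_card this).trans (card_union_le _ _)
      omega
    have hne1 : l1 ≠ [] := by rintro rfl; simp at hcard; omega
    have hne2 : l2 ≠ [] := by rintro rfl; simp at hcard2; omega
    have hpt' := hpt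
    rw [hll] at hpt'
    obtain ⟨u1, u2, hP1, hP2, hadj, hdisj⟩ := hpt'.split hne1 hne2
    have half : ∀ l' x' y' O', PT G x' y' l' → (∀ u v, Nx l' u v → Nx l u v) → (∀ v ∈ l', v ∈ l) → O' ⊆ O →
        10 * p ^ 2 ≤ (R2.filter (· ∈ l')).card →
        (∀ u, (O.filter (G.Adj u)).card ≤ (O'.filter (G.Adj u)).card + 1) → 
        ∃ o ∈ O', ∃ l'', PT G x' y' l'' ∧ l''.Perm (o :: l') := by
      intro l' x' y' O' hP hNx hmem hO' hc hO''
      set R3 := (R2.filter (· ∈ l')).erase y' with hR3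
      have hR3c : 9 * p ^ 2 ≤ R3.card := by
        have : (R2.filter (· ∈ l')).card - 1 ≤ R3.card := pred_card_le_card_erase
        omega
      have hR3R : R3 ⊆ R2 := (erase_subset _ _).trans (filter_subset _ _)
      refine halfInsert G hP R3 O' (r0 - 1) k s ?_ ?_ ?_ ?_ ?_
      · intro u hu
        have hu' := hu
        simp only [hR3, mem_erase, mem_filter] at hu
        obtain ⟨v, hv⟩ := Nx.exists hP hu.2.2 hu.1
        have : v = s u := Nx.uniq hpt.1 (hNx _ _ hv) (hsR u (hR2R (hR3R hu')))
        exact this ▸ hv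
      · intro o ho hol
        have h3 := hOl o (hO' ho)
        exact h3 (hmem o hol)
      · intro u hu
        have := hrR u (hR2R (hR3R hu))
        have := hO'' u
        omega
      · intro R' hR' hk hI
        have := few (R'.image s) (by
          intro w hw
          obtain ⟨u, hu, rfl⟩ := mem_image.1 hw
          simpa [hL] using (hsR u (hR2R (hR3R (hR' hu)))).mem_right) hI (by
          intro w hw
          obtain ⟨u, hu, rfl⟩ := mem_image.1 hw
          have := hR3R (hR' hu)
          simp only [hR2, mem_filter] at this
          omega)
        omega
      · have h3 : O'.card ≤ p * m := (card_le_card hO').trans hOc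
        have h4 : k * O'.card ≤ p * (p * m) := Nat.mul_le_mul hkp h3
        have h5 : 9 * p ^ 2 * (r0 - 1) ≤ R3.card * (r0 - 1) := Nat.mul_le_mul_right _ hR3c
        have h6 : p ^ 2 * (9 * (r0 - 1)) > p ^ 2 * m :=
          Nat.mul_lt_mul_of_pos_left (by omega) (by positivity)
        nlinarith
    obtain ⟨o, ho, l1', hP1', hperm1⟩ := half l1 x u1 O hP1
      (fun u v h => hll ▸ h.append_left) (fun v hv => by rw [hll]; simp [hv]) (Subset.refl _) hcard.ge (fun u => by omega)
    obtain ⟨o', ho', l2', hP2', hperm2⟩ := half l2 u2 y (O.erase o) hP2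
      (fun u v h => hll ▸ h.append_right) (fun v hv => by rw [hll]; simp [hv]) (erase_subset _ _) hcard2 (fun u => by
        rw [filter_erase]
        have h5 := pred_card_le_card_erase (s := O.filter (G.Adj u)) (a := o)
        omega)
    simp only [mem_erase] at ho'
    have hol := hOl o ho
    have hol' := hOl o' ho'.2
    rw [hll] at hol hol'
    simp at hol hol'
    refine hclose o o' (l1' ++ l2') (hOl o ho) (hOl o' ho'.2) (hP1'.append hP2' hadj ?_) ?_
    · intro v hv hv'
      have h5 := hperm1.subset hv
      have h6 := hperm2.subset hv'
      simp at h5 h6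
      rcases h5 with rfl | h5 <;> rcases h6 with h6 | h6
      · exact ho'.1 h6.symm
      · tauto
      · subst h6; tauto
      · exact hdisj v h5 h6
    · rw [hll]
      refine (hperm1.append hperm2).trans ?_
      rw [List.perm_iff_count]
      intro a
      simp [List.count_cons]; omega

end

-- D
section
open Classical Finset

variable {V : Type*} [Fintype V]

noncomputable def cdeg (G : SimpleGraph V) (x y : V) : Finset V :=
  univ.filter fun w => G.Adj x w ∧ G.Adj y w

theorem zigzag (G Γ : SimpleGraph V) (A : Finset V) (hA : Ind G A) (c : ℕ)
    (hΓ : ∀ x y, Γ.Adj x y → c ≤ (cdeg G x y).card) :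
    ∀ l x y, PT Γ x y l → (∀ v ∈ l, v ∈ A) → 2 * l.length ≤ c →
      ∃ l', PT G x y l' ∧ l'.length + 1 = 2 * l.length ∧ (∀ v ∈ l, v ∈ l') ∧
        (∀ v ∈ l', v ∈ A → v ∈ l) := by
  intro l
  induction l with
  | nil => intro x y h; exact absurd rfl h.ne_nil
  | cons a l ih =>
    intro x y h hlA hc
    have hax : a = x := by have := h.2.2.1; simpa using this
    subst hax
    by_cases hl : l = []
    · subst hl
      have : y = a := by have := h.2.2.2; simp at this; exact this.symm
      subst this
      exact ⟨[y], PT.single _ _, by simp, by simp, by simp⟩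
    · have e : a :: l = [a] ++ l := rfl
      rw [e] at h
      obtain ⟨u, v, h1, h2, h3, h4⟩ := h.split (by simp) hl
      have : u = a := by have := h1.2.2.2; simp at this; exact this.symm
      subst this
      simp at hc hlA h4
      obtain ⟨l', g1, g2, g3, g4⟩ := ih v y h2 hlA.2 (by omega)
      obtain ⟨w, hw, hwl⟩ : ∃ w ∈ cdeg G u v, w ∉ l' := by
        by_contra hcon
        push Not at hcon
        have := card_le_card (s := cdeg G u v) (t := l'.toFinset) (fun w hw => by simpa using hcon w hw)
        rw [List.toFinset_card_of_nodup g1.1] at this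
        have := hΓ u v h3
        omega
      simp [cdeg] at hw
      have hwA : w ∉ A := fun hh => hA u hlA.1 w hh hw.1
      have hul' : u ∉ l' := fun hh => h4 (g4 u hh hlA.1)
      refine ⟨u :: w :: l', PT.cons (PT.cons g1 hw.2.symm hwl) hw.1 ?_, ?_, ?_, ?_⟩
      · simp; exact ⟨hw.1.ne, hul'⟩
      · simp; omega
      · intro z hz; simp at hz ⊢
        rcases hz with rfl | hz
        · simp
        · right; right; exact g3 z hz
      · intro z hz hzA
        simp at hz ⊢
        rcases hz with rfl | rfl | hz
        · simp
        · exact absurd hzA hwA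
        · right; exact g4 z hz hzA

theorem zigzag_cycle (G Γ : SimpleGraph V) (A : Finset V) (hA : Ind G A) (c : ℕ)
    (hΓ : ∀ x y, Γ.Adj x y → c ≤ (cdeg G x y).card) (l : List V) (hl : CL Γ l)
    (hlA : ∀ v ∈ l, v ∈ A) (hc : 2 * l.length ≤ c) :
    ∃ l', CL G l' ∧ l'.length = 2 * l.length ∧ (∀ v ∈ l, v ∈ l') := by
  obtain ⟨h3, x, y, hp, hyx⟩ := hl
  obtain ⟨l', g1, g2, g3, g4⟩ := zigzag G Γ A hA c hΓ l x y hp hlA hc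
  obtain ⟨w, hw, hwl⟩ : ∃ w ∈ cdeg G y x, w ∉ l' := by
    by_contra hcon
    push Not at hcon
    have := card_le_card (s := cdeg G y x) (t := l'.toFinset) (fun w hw => by simpa using hcon w hw)
    rw [List.toFinset_card_of_nodup g1.1] at this
    have := hΓ y x hyx
    omega
  simp [cdeg] at hw
  refine ⟨w :: l', ⟨by simp; omega, w, y, PT.cons g1 hw.2.symm hwl, hw.1⟩, by simp; omega, fun v hv => ?_⟩
  simp [g3 v hv]

theorem bonferroni (G : SimpleGraph V) (r c : ℕ) (S : Finset V)
    (hd : ∀ u ∈ S, r ≤ (univ.filter (G.Adj u)).card)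
    (hc : ∀ u ∈ S, ∀ v ∈ S, u ≠ v → (cdeg G u v).card ≤ c) :
    S.card * r ≤ (S.biUnion fun u => univ.filter (G.Adj u)).card + S.card ^ 2 * c := by
  induction S using Finset.induction_on with
  | empty => simp
  | insert a S ha ih =>
    have ih' := ih (fun u hu => hd u (mem_insert_of_mem hu))
      (fun u hu v hv => hc u (mem_insert_of_mem hu) v (mem_insert_of_mem hv))
    rw [biUnion_insert, card_insert_of_notMem ha]
    set U := S.biUnion fun u => univ.filter (G.Adj u)
    set Na := univ.filter (G.Adj a)
    have h1 := card_union_add_card_inter Na U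
    have h2 : (Na ∩ U).card ≤ S.card * c := by
      have : Na ∩ U ⊆ S.biUnion fun u => cdeg G a u := by
        intro w hw
        simp [Na, U, cdeg] at hw ⊢
        obtain ⟨h1, u, h2, h3⟩ := hw
        exact ⟨u, h2, h1, h3⟩
      refine (card_le_card this).trans (card_biUnion_le_card_mul _ _ _ fun u hu => ?_)
      exact hc a (mem_insert_self _ _) u (mem_insert_of_mem hu) (fun h => ha (h ▸ hu))
    have h3 := hd a (mem_insert_self _ _)
    change r ≤ Na.card at h3
    nlinarith [Nat.zero_le (S.card * c), Nat.zero_le c]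

theorem alphaBound (G : SimpleGraph V) (p k m K : ℕ) (hp : 5 ≤ p) (hk : 1 ≤ k) (hkp : k ≤ p)
    (hN : Fintype.card V ≤ p * m) (hm : 100000 * p ^ 4 ≤ m) (hme : Even m)
    (hB : BC G k K) (hK : m + k * (m / 4) < K) (hno : ¬ ∃ l, CL G l ∧ l.length = m)
    (A : Finset V) (hA : Ind G A) : A.card ≤ 330 * p ^ 3 := by
  by_contra hcon
  push Not at hcon
  obtain ⟨A0, hA0, hA0c⟩ := exists_subset_card_eq (s := A) (n := 330 * p ^ 3 + 1) (by omega)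
  replace hA := hA.subset hA0
  clear hcon hA0
  obtain ⟨r0, hr0⟩ : ∃ r0, r0 = m / 4 := ⟨_, rfl⟩
  rw [← hr0] at hK
  have hp2 : 25 ≤ p ^ 2 := by nlinarith
  have hp3 : 5 * p ^ 2 ≤ p ^ 3 := by rw [pow_succ p 2]; nlinarith
  have hp4 : p ^ 4 = p * p ^ 3 := by ring
  have hpp : 5 * p ≤ p ^ 2 := by nlinarith
  have hp34 : 5 * p ^ 3 ≤ p ^ 4 := by rw [hp4]; nlinarith
  set r := p ^ 3 with hr
  set A' := A0.filter (fun u => r0 ≤ (univ.filter (G.Adj u)).card) with hA'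
  have hA'c : 330 * r + 1 < A'.card + k := by
    have := hB.few A0 r0 (by omega) (A0.filter fun u => ((univ \ A0).filter (G.Adj u)).card < r0)
      (filter_subset _ _) (hA.subset (filter_subset _ _)) (fun u hu => (mem_filter.1 hu).2)
    have hsub : A0 ⊆ A' ∪ (A0.filter fun u => ((univ \ A0).filter (G.Adj u)).card < r0) := by
      intro u hu
      by_cases h : ((univ \ A0).filter (G.Adj u)).card < r0
      · exact mem_union_right _ (mem_filter.2 ⟨hu, h⟩)
      · refine mem_union_left _ (mem_filter.2 ⟨hu, (not_lt.1 h).trans (card_le_card ?_)⟩)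
        exact filter_subset_filter _ (subset_univ _)
    have := (card_le_card hsub).trans (card_union_le _ _)
    omega
  let c := 660 * r + 5
  let Γ : SimpleGraph V :=
    { Adj := fun x y => x ≠ y ∧ c ≤ (cdeg G x y).card
      symm := ⟨by
        intro x y h
        refine ⟨h.1.symm, h.2.trans (card_le_card ?_)⟩
        intro w; simp [cdeg]; tauto⟩
      loopless := ⟨fun x h => h.1 rfl⟩ }
  have hΓ : ∀ x y, Γ.Adj x y → c ≤ (cdeg G x y).card := fun x y h => h.2
  obtain ⟨l, hl, hlA, hlen⟩ : ∃ l, CL Γ l ∧ (∀ v ∈ l, v ∈ A') ∧ 40 * p ^ 2 + k < l.length := by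
    by_contra hno
    push Not at hno
    obtain ⟨I, hI, hind, hc⟩ := greedyInd Γ (40 * p ^ 2 + k - 1) A' (fun U' hU' hne => 
      lemP Γ U' hne (40 * p ^ 2 + k) (by omega) fun l h h' => hno l h fun v hv => hU' (h' v hv))
    have hI8 : I.card < 8 * p := by
      by_contra hcon
      push Not at hcon
      obtain ⟨S, hS, hSc⟩ := exists_subset_card_eq hcon
      have := bonferroni G r0 c S (fun u hu => (mem_filter.1 (hI (hS hu))).2) (by
        intro u hu v hv huv
        have : ¬ (u ≠ v ∧ c ≤ (cdeg G u v).card) := hind u (hS hu) v (hS hv)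
        push Not at this
        exact (this huv).le)
      have h2 := (card_le_univ (S.biUnion fun u => univ.filter (G.Adj u))).trans hN
      rw [hSc] at this
      have h3 : 8 * p * r0 ≤ p * m + (8 * p) ^ 2 * c := by omega
      have h4 : p * (8 * r0) ≤ p * (m + 64 * (p * c)) := by nlinarith
      have h5 := Nat.le_of_mul_le_mul_left h4 (by omega)
      have h6 : p * c = 660 * p ^ 4 + 5 * p := by rw [hp4]; ring
      omega
    have e : 40 * p ^ 2 + k - 1 + 1 = 40 * p ^ 2 + k := by omega
    rw [e] at hc
    have h7 : (40 * p ^ 2 + k) * I.card ≤ (40 * p ^ 2 + p) * (8 * p) :=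
      Nat.mul_le_mul (by omega) hI8.le
    have h8 : (40 * p ^ 2 + p) * (8 * p) = 320 * r + 8 * p ^ 2 := by rw [hr]; ring
    omega
  have hA'A : ∀ v ∈ l, v ∈ A0 := fun v hv => (mem_filter.1 (hlA v hv)).1
  have hll : l.length ≤ 330 * r + 1 := by
    obtain ⟨_, x, y, hp, _⟩ := hl
    have := nodup_length_le hp.1 hA'A; omega
  obtain ⟨l1, hl1, hlen1, hsub1⟩ := zigzag_cycle G Γ A0 hA c hΓ l hl hA'A (by omega)
  have hnd : l.Nodup := by obtain ⟨_, x, y, hp, _⟩ := hl; exact hp.1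
  have grow : ∀ j, 2 * l.length + 2 * j ≤ m → ∃ l', CL G l' ∧ l'.length = 2 * l.length + 2 * j ∧
      ∀ v ∈ l, v ∈ l' := by
    intro j
    induction j with
    | zero => intro _; exact ⟨l1, hl1, by omega, hsub1⟩
    | succ j ih =>
      intro hj
      obtain ⟨l2, hl2, hlen2, hsub2⟩ := ih (by omega)
      obtain ⟨l3, hl3, hlen3, hsub3⟩ := growth G p k m K r0 hp hkp hN (by omega) (by omega) (by omega) hB hK
        l2 hl2 (by omega) l.toFinset (fun v hv => hsub2 v (by simpa using hv))
        (hA.subset fun v hv => hA'A v (by simpa using hv)) (by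
          rw [List.toFinset_card_of_nodup hnd]; omega)
      exact ⟨l3, hl3, by omega, fun v hv => hsub3 v (hsub2 v hv)⟩
  obtain ⟨m', hm'⟩ := hme
  obtain ⟨l', h1, h2, -⟩ := grow (m' - l.length) (by omega)
  exact hno ⟨l', h1, by omega⟩

end

-- E
section
open Classical Finset

variable {V : Type*}

def AlphaLE (G : SimpleGraph V) (a : ℕ) : Prop := ∀ A, Ind G A → A.card ≤ a

theorem AlphaLE.exists_adj {G : SimpleGraph V} {a} (h : AlphaLE G a) (S : Finset V) (hS : a < S.card) :
    ∃ u ∈ S, ∃ v ∈ S, G.Adj u v := by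
  by_contra hcon
  push Not at hcon
  have := h S hcon
  omega

theorem PT.insertOne {G : SimpleGraph V} {a} (hα : AlphaLE G a) {x y l} (h : PT G x y l) {z}
    (hz : z ∉ l) (hd : a + 2 ≤ (l.toFinset.filter (G.Adj z)).card) :
    ∃ l', PT G x y l' ∧ l'.Perm (z :: l) := by
  obtain ⟨s, hs, hinj⟩ := h.exists_succ
  set R := (l.toFinset.filter (G.Adj z)).erase y with hR
  have hRc : a < R.card := by
    have : (l.toFinset.filter (G.Adj z)).card - 1 ≤ R.card := pred_card_le_card_erase
    omega
  have hRl : ∀ u ∈ R, u ∈ l ∧ u ≠ y ∧ G.Adj z u := by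
    intro u hu; simp [hR] at hu; tauto
  obtain ⟨u', hu', v', hv', hadj⟩ := hα.exists_adj (R.image s) (by
    rw [card_image_of_injOn]
    · exact hRc
    · intro u hu v hv e
      exact hinj u (hRl u hu).1 (hRl u hu).2.1 v (hRl v hv).1 (hRl v hv).2.1 e)
  obtain ⟨u, hu, rfl⟩ := mem_image.1 hu'
  obtain ⟨v, hv, rfl⟩ := mem_image.1 hv'
  have huv : u ≠ v := by rintro rfl; exact G.loopless.irrefl _ hadj
  have h1 := hRl u hu
  have h2 := hRl v hv
  exact h.insert (hs u h1.1 h1.2.1) (hs v h2.1 h2.2.1) huv hadj hz h1.2.2 h2.2.2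

theorem PT.insertMany {G : SimpleGraph V} {a} (hα : AlphaLE G a) {x y} (Y : List V) :
    ∀ l, PT G x y l → Y.Nodup → (∀ z ∈ Y, z ∉ l) →
    (∀ z ∈ Y, a + 2 ≤ (l.toFinset.filter (G.Adj z)).card) →
    ∃ l', PT G x y l' ∧ l'.Perm (Y ++ l) := by
  induction Y with
  | nil => intro l h _ _ _; exact ⟨l, h, by simp⟩
  | cons z Y ih =>
    intro l h hnd hdisj hd
    simp at hnd hdisj hd
    obtain ⟨l1, h1, hp1⟩ := h.insertOne hα hdisj.1 hd.1
    obtain ⟨l2, h2, hp2⟩ := ih l1 h1 hnd.2 (by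
      intro w hw hw'
      have := hp1.subset hw'
      simp at this
      rcases this with rfl | this
      · exact hnd.1 hw
      · exact hdisj.2 w hw this) (by
      intro w hw
      refine (hd.2 w hw).trans (card_le_card (filter_subset_filter _ ?_))
      intro v hv
      simp at hv ⊢
      exact hp1.symm.subset (by simp [hv]))
    refine ⟨l2, h2, hp2.trans ?_⟩
    rw [List.perm_iff_count]
    intro b
    have := List.perm_iff_count.1 hp1 b
    simp [List.count_cons] at this ⊢; omega

theorem chunk_exists (P : V → Prop) (w b : ℕ) : ∀ l : List V, l.countP P ≤ b →
    w * (b + 1) ≤ l.length → ∃ A C D, l = A ++ C ++ D ∧ C.length = w ∧ ∀ v ∈ C, ¬ P v := by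
  induction b with
  | zero =>
    intro l h1 h2
    refine ⟨[], l.take w, l.drop w, by simp, by simp; omega, ?_⟩
    intro v hv hP
    have : 0 < l.countP P := List.countP_pos_iff.2 ⟨v, List.mem_of_mem_take hv, by simpa using hP⟩
    omega
  | succ b ih =>
    intro l h1 h2
    have h3 : w * (b + 1 + 1) = w * (b + 1) + w := by ring
    by_cases h : ∃ v ∈ l.take w, P v
    · obtain ⟨v, hv, hP⟩ := h
      have : 0 < (l.take w).countP P := List.countP_pos_iff.2 ⟨v, hv, by simpa using hP⟩
      have h4 : l.countP P = (l.take w).countP P + (l.drop w).countP P := by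
        rw [← List.countP_append, List.take_append_drop]
      obtain ⟨A, C, D, e, hC⟩ := ih (l.drop w) (by omega) (by simp; omega)
      refine ⟨l.take w ++ A, C, D, ?_, hC⟩
      have h5 := List.take_append_drop w l
      rw [e] at h5; rw [← List.append_assoc, ← List.append_assoc] at *; exact h5.symm
    · push Not at h
      exact ⟨[], l.take w, l.drop w, by simp, by simp; omega, h⟩

theorem list_split_two (l : List V) (i j : ℕ) (hij : i < j) (hj : j < l.length) :
    ∃ X Y Z, l = X ++ l[i] :: (Y ++ l[j] :: Z) ∧ Y.length = j - i - 1 := by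
  refine ⟨l.take i, (l.drop (i + 1)).take (j - i - 1), l.drop (j + 1), ?_, by simp; omega⟩
  have h1 : l.drop j = l[j] :: l.drop (j + 1) := List.drop_eq_getElem_cons hj
  have h2 : l.drop i = l[i] :: l.drop (i + 1) := List.drop_eq_getElem_cons (by omega)
  have h3 : l.drop j = (l.drop (i + 1)).drop (j - i - 1) := by
    rw [List.drop_drop]; congr 1; omega
  rw [← h1, h3, List.take_append_drop, ← h2, List.take_append_drop]

theorem even_chord (G : SimpleGraph V) {a} (hα : AlphaLE G a) (C : List V) (hnd : C.Nodup)
    (hC : C.length = 2 * a + 1) : ∃ X u Y w Z, C = X ++ u :: (Y ++ w :: Z) ∧ 1 ≤ Y.length ∧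
      Y.length < 2 * a + 1 ∧ G.Adj u w := by
  let f : Fin (a + 1) → V := fun i => C[2 * (i : ℕ)]'(by omega)
  have hinj : Function.Injective f := by
    intro i j h
    have := (List.Nodup.getElem_inj_iff hnd).1 h
    ext; omega
  obtain ⟨u, hu, v, hv, hadj⟩ := hα.exists_adj (univ.image f) (by
    rw [card_image_of_injective _ hinj]; simp)
  obtain ⟨i, -, rfl⟩ := mem_image.1 hu
  obtain ⟨j, -, rfl⟩ := mem_image.1 hv
  have hij : i ≠ j := by rintro rfl; exact G.loopless.irrefl _ hadj
  rcases lt_or_gt_of_ne hij with h | h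
  · obtain ⟨X, Y, Z, e, hY⟩ := list_split_two C (2 * (i : ℕ)) (2 * (j : ℕ)) (by omega) (by omega)
    exact ⟨X, _, Y, _, Z, e, by omega, by omega, hadj⟩
  · obtain ⟨X, Y, Z, e, hY⟩ := list_split_two C (2 * (j : ℕ)) (2 * (i : ℕ)) (by omega) (by omega)
    exact ⟨X, _, Y, _, Z, e, by omega, by omega, hadj.symm⟩

theorem shrink (G : SimpleGraph V) {a} (hα : AlphaLE G a) (l : List V) (hl : CL G l)
    (hlen : (2 * a + 1) * ((3 * a + 4) * a + 1) ≤ l.length) (hlen4 : 2 * a + 4 ≤ l.length) :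
    ∃ l', CL G l' ∧ l'.length + 1 = l.length := by
  set L := l.toFinset with hL
  have hnd : l.Nodup := by obtain ⟨_, _, _, hp, _⟩ := hl; exact hp.1
  let Pr : V → Prop := fun v => (L.filter (G.Adj v)).card ≤ 3 * a + 3
  have hpoor : (L.filter Pr).card ≤ (3 * a + 4) * a := by
    obtain ⟨I, hI, hind, hc⟩ := greedyInd G (3 * a + 3) (L.filter Pr) (by
      rintro U' hU' ⟨v, hv⟩
      refine ⟨v, hv, ?_⟩
      have := (mem_filter.1 (hU' hv)).2
      refine le_trans (card_le_card ?_) this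
      exact filter_subset_filter _ (hU'.trans (filter_subset _ _)))
    exact hc.trans (Nat.mul_le_mul_left _ (hα I hind))
  have hcount : l.countP Pr ≤ (3 * a + 4) * a := by
    rw [List.countP_eq_length_filter]
    refine le_trans (nodup_length_le (hnd.filter _) ?_) hpoor
    intro v hv; simp at hv; simp [hL, hv]
  obtain ⟨A, C, D, e, hC, hCP⟩ := chunk_exists Pr (2 * a + 1) _ l (by convert hcount) hlen
  have hCnd : C.Nodup := by rw [e] at hnd; simp [List.nodup_append] at hnd; tauto
  obtain ⟨X, u, Y, w, Z, eC, hY1, hY2, huw⟩ := even_chord G hα C hCnd hC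
  have hl' : CL G ((X ++ [u]) ++ (Y ++ (w :: (Z ++ D ++ A)))) := by
    have : CL G (A ++ (C ++ D)) := by rw [← List.append_assoc, ← e]; exact hl
    have := this.rotate
    rw [eC] at this; simpa using this
  have hlmem : ∀ v, v ∈ l ↔ v ∈ (X ++ [u]) ++ (Y ++ (w :: (Z ++ D ++ A))) := by
    intro v; rw [e, eC]; simp; tauto
  have hllen : l.length = X.length + 1 + Y.length + 1 + Z.length + D.length + A.length := by
    rw [e, eC]; simp; omega
  obtain ⟨_, x, y, hp, hyx⟩ := hl'
  obtain ⟨u1, v1, hp1, hp2, -, hd1⟩ := hp.split (by simp) (by simp)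
  obtain ⟨u2, v2, hp3, hp4, -, hd2⟩ := hp2.split (by intro h; simp [h] at hY1) (by simp)
  have e1 : u1 = u := by have := hp1.2.2.2; simp at this; exact this.symm
  have e2 : v2 = w := by have := hp4.2.2.1; simp at this; exact this.symm
  rw [e1] at hp1; rw [e2] at hp4
  have hp5 := hp1.append hp4 huw (fun v hv hv' => hd1 v hv (List.mem_append_right _ hv'))
  obtain ⟨l', hl', hperm⟩ := hp5.insertMany hα Y.tail _ hp3.1.tail (by
    intro z hz hz'
    have hzY := List.mem_of_mem_tail hz
    rw [List.mem_append] at hz'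
    rcases hz' with h | h
    · exact hd1 z h (List.mem_append_left _ hzY)
    · exact hd2 z hzY h) (by
    intro z hz
    have hzY := List.mem_of_mem_tail hz
    have hzP := hCP z (by rw [eC]; simp [hzY])
    simp only [Pr, not_le] at hzP
    have hsub : L.filter (G.Adj z) ⊆ ((X ++ [u] ++ w :: (Z ++ D ++ A)).toFinset.filter (G.Adj z)) ∪ Y.toFinset := by
      intro v hv
      rw [mem_filter, hL, List.mem_toFinset, hlmem] at hv
      simp at hv ⊢; tauto
    have h6 := (card_le_card hsub).trans (card_union_le _ _)
    have h7 := List.toFinset_card_le Y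
    omega)
  have hlen' := hperm.length_eq
  simp at hlen'
  exact ⟨l', ⟨by omega, x, y, hl', hyx⟩, by omega⟩

theorem noLong (G : SimpleGraph V) {a m} (hα : AlphaLE G a)
    (hm : (2 * a + 1) * ((3 * a + 4) * a + 1) ≤ m) (hm4 : 2 * a + 4 ≤ m)
    (hno : ¬ ∃ l, CL G l ∧ l.length = m) : ∀ l, CL G l → l.length + 1 ≤ m := by
  intro l hl
  by_contra hcon
  push Not at hcon
  have : ∀ ℓ, m ≤ ℓ → ∀ l, CL G l → l.length ≠ ℓ := by
    intro ℓ hℓ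
    induction ℓ, hℓ using Nat.le_induction with
    | base => intro l h1 h2; exact hno ⟨l, h1, h2⟩
    | succ ℓ hℓ ih =>
      intro l h1 h2
      obtain ⟨l', h3, h4⟩ := shrink G hα l h1 (by omega) (by omega)
      exact ih l' h3 (by omega)
  exact this l.length (by omega) l hl rfl

end

-- F
section
open Classical Finset

variable {V : Type*}

theorem BC2 [Fintype V] (G : SimpleGraph V) (k m : ℕ) (hk : 3 ≤ k) (hm : 3 ≤ m)
    (hB : BC G k ((k - 1) * (m - 1) + 2)) (hN : k * (m - 1) + m ≤ Fintype.card V)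
    (hcirc : ∀ l, CL G l → l.length + 1 ≤ m) (x y : V) (hxy : x ≠ y) (hadj : ¬ G.Adj x y) :
    m + 1 ≤ (cn G {x, y}).card := by
  by_contra hcon
  push Not at hcon
  have key : ∀ j, j + 2 ≤ k → ∃ S, Ind G S ∧ S.card = j + 2 ∧ (cn G S).card ≤ m + j * (m - 1) := by
    intro j
    induction j with
    | zero =>
      intro _
      refine ⟨{x, y}, ?_, card_pair hxy, by omega⟩
      intro u hu v hv
      simp at hu hv
      rcases hu with rfl | rfl <;> rcases hv with rfl | rfl
      · simp
      · exact hadj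
      · exact fun h => hadj h.symm
      · simp
    | succ j ih =>
      intro hj
      obtain ⟨S, h1, h2, h3⟩ := ih (by omega)
      have hne : (univ \ cn G S).Nonempty := by
        rw [← card_pos, card_sdiff_of_subset (subset_univ _), card_univ]
        have : j * (m - 1) ≤ k * (m - 1) := Nat.mul_le_mul_right _ (by omega)
        have : (j + 1) * (m - 1) ≤ k * (m - 1) := Nat.mul_le_mul_right _ (by omega)
        have : (j + 1) * (m - 1) = j * (m - 1) + (m - 1) := by ring
        omega
      obtain ⟨z, hz, hd⟩ := lemP G (univ \ cn G S) hne (m - 1) (by omega)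
        (fun l hl _ => by have := hcirc l hl; omega)
      have hzS : ∀ s ∈ S, z ≠ s ∧ ¬ G.Adj s z := by
        intro s hs
        simp [cn] at hz
        exact hz s hs
      refine ⟨insert z S, ?_, ?_, ?_⟩
      · intro u hu v hv
        rcases mem_insert.1 hu with hu | hu <;> rcases mem_insert.1 hv with hv | hv
        · rw [hu, hv]; simp
        · rw [hu]; exact fun h => (hzS v hv).2 h.symm
        · rw [hv]; exact (hzS u hu).2
        · exact h1 u hu v hv
      · rw [card_insert_of_notMem (fun h => (hzS z h).1 rfl)]; omega
      · have hsub : cn G (insert z S) ⊆ cn G S ∪ insert z ((univ \ cn G S).filter (G.Adj z)) := by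
          intro v hv
          by_cases hvS : v ∈ cn G S
          · exact mem_union_left _ hvS
          · refine mem_union_right _ ?_
            simp only [mem_insert, mem_filter, mem_sdiff, mem_univ, true_and, hvS, not_false_eq_true]
            simp only [cn, mem_filter, mem_univ, true_and, mem_insert] at hv hvS
            obtain ⟨s, rfl | hs, h⟩ := hv
            · exact h
            · exact absurd ⟨s, hs, h⟩ hvS
        have h4 := (card_le_card hsub).trans (card_union_le _ _)
        have h5 := card_insert_le z ((univ \ cn G S).filter (G.Adj z))
        have : (j + 1) * (m - 1) = j * (m - 1) + (m - 1) := by ring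
        omega
  obtain ⟨S, h1, h2, h3⟩ := key (k - 2) (by omega)
  have h4 := hB S h1 (by omega)
  have : (k - 1) * (m - 1) = (k - 2) * (m - 1) + (m - 1) := by
    obtain ⟨q, rfl⟩ : ∃ q, k = q + 2 := ⟨k - 2, by omega⟩
    simp; ring
  omega

def InSep (G : SimpleGraph V) (W : Finset V) (c : ℕ) : Prop :=
  ∀ Y ⊆ W, Y.card ≤ c → ∀ A B : Finset V, A ∪ B = W \ Y → Disjoint A B → A.Nonempty → B.Nonempty →
    ∃ u ∈ A, ∃ v ∈ B, G.Adj u v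

theorem InSep.insert {G : SimpleGraph V} {W : Finset V} {c} (h : InSep G W c) {x} (hx : x ∉ W)
    (hd : c + 1 ≤ (W.filter (G.Adj x)).card) : InSep G (insert x W) c := by
  intro Y hY hYc A B hAB hdis hA hB
  by_cases hxY : x ∈ Y
  · refine h (Y.erase x) ?_ ((card_le_card (erase_subset _ _)).trans hYc) A B ?_ hdis hA hB
    · intro v hv
      simp at hv
      have := hY hv.2
      simp [hv.1] at this; exact this
    · rw [hAB]; ext v; simp
      by_cases hv : v = x
      · subst hv; simp [hx, hxY]
      · simp [hv]
  · have hYW : Y ⊆ W := by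
      intro v hv
      have := hY hv
      simp at this
      rcases this with rfl | h
      · exact absurd hv hxY
      · exact h
    have key : ∀ A B : Finset V, A ∪ B = Insert.insert x W \ Y → Disjoint A B → A.Nonempty → B.Nonempty →
        x ∈ A → ∃ u ∈ A, ∃ v ∈ B, G.Adj u v := by
      intro A B hAB hdis hA hB hxA
      have hxB : x ∉ B := disjoint_left.1 hdis hxA
      by_cases hA' : (A.erase x).Nonempty
      · obtain ⟨u, hu, v, hv, ha⟩ := h Y hYW hYc (A.erase x) B (by
          have : W \ Y = (A ∪ B).erase x := by
            rw [hAB]; ext v; simp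
            by_cases hv : v = x
            · subst hv; simp [hx]
            · simp [hv]
          rw [this, erase_union_distrib, erase_eq_of_notMem hxB]) (hdis.mono_left (erase_subset _ _)) hA' hB
        exact ⟨u, mem_of_mem_erase hu, v, hv, ha⟩
      · obtain ⟨w, hw, hwY⟩ : ∃ w ∈ W.filter (G.Adj x), w ∉ Y := by
          by_contra hcon
          push Not at hcon
          have := card_le_card (s := W.filter (G.Adj x)) (t := Y) hcon
          omega
        simp at hw
        have hwAB : w ∈ A ∪ B := by rw [hAB]; simp [hw, hwY]
        refine ⟨x, hxA, w, ?_, hw.2⟩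
        rcases mem_union.1 hwAB with h1 | h1
        · exact absurd ⟨w, mem_erase.2 ⟨hw.2.ne', h1⟩⟩ hA'
        · exact h1
    have hxAB : x ∈ A ∪ B := by rw [hAB]; simp [hxY]
    rcases mem_union.1 hxAB with h1 | h1
    · exact key A B hAB hdis hA hB h1
    · obtain ⟨u, hu, v, hv, ha⟩ := key B A (by rw [union_comm]; exact hAB) hdis.symm hB hA h1
      exact ⟨v, hv, u, hu, ha.symm⟩

theorem InSep.union {G : SimpleGraph V} {W : Finset V} {c} (h : InSep G W c) (T : Finset V)
    (hT : ∀ x ∈ T, x ∉ W) (hd : ∀ x ∈ T, c + 1 ≤ (W.filter (G.Adj x)).card) : InSep G (W ∪ T) c := by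
  induction T using Finset.induction_on with
  | empty => simpa using h
  | insert a T ha ih =>
    have := ih (fun x hx => hT x (mem_insert_of_mem hx)) (fun x hx => hd x (mem_insert_of_mem hx))
    rw [union_insert]
    refine this.insert ?_ ?_
    · simp [ha, hT a (mem_insert_self _ _)]
    · exact (hd a (mem_insert_self _ _)).trans (card_le_card (filter_subset_filter _ subset_union_left))

def Rch (G : SimpleGraph V) (S : Finset V) (x y : V) : Prop :=
  Relation.ReflTransGen (fun u v => G.Adj u v ∧ u ∈ S ∧ v ∈ S) x y

theorem Rch.symm {G : SimpleGraph V} {S x y} (h : Rch G S x y) : Rch G S y x :=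
  haveI : Std.Symm (fun u v => G.Adj u v ∧ u ∈ S ∧ v ∈ S) := ⟨fun _ _ h => ⟨h.1.symm, h.2.2, h.2.1⟩⟩
  Relation.ReflTransGen.stdSymm.symm _ _ h

theorem Rch.exists_PT {G : SimpleGraph V} {S x y} (h : Rch G S x y) (hy : y ∈ S) :
    ∃ l, PT G x y l ∧ ∀ v ∈ l, v ∈ S := by
  induction h using Relation.ReflTransGen.head_induction_on with
  | refl => exact ⟨[y], PT.single G y, by simpa using hy⟩
  | head h1 h2 ih =>
    rename_i a c
    obtain ⟨l, hp, hl⟩ := ih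
    by_cases ha : a ∈ l
    · obtain ⟨A, B, rfl⟩ := List.append_of_mem ha
      by_cases hA : A = []
      · subst hA
        refine ⟨a :: B, ?_, hl⟩
        have : c = a := by have := hp.2.2.1; simp at this; exact this.symm
        exact this ▸ hp
      · obtain ⟨u, v, -, h4, -⟩ := hp.split hA (by simp)
        have : v = a := by have := h4.2.2.1; simp at this; exact this.symm
        exact ⟨a :: B, this ▸ h4, fun v hv => hl v (List.mem_append_right _ hv)⟩
    · exact ⟨a :: l, hp.cons h1.1 ha, by simpa using ⟨h1.2.1, hl⟩⟩

theorem InSep.rch {G : SimpleGraph V} {W c} (h : InSep G W c) {x y} (hx : x ∈ W) (hy : y ∈ W) :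
    Rch G W x y := by
  by_contra hcon
  obtain ⟨u, hu, v, hv, ha⟩ := h ∅ (by simp) (by simp) (W.filter (Rch G W x)) (W.filter (fun v => ¬ Rch G W x v))
    (by rw [filter_union_filter_not_eq]; simp) (disjoint_filter_filter_not _ _ _)
    ⟨x, by simp [hx]; exact Relation.ReflTransGen.refl⟩ ⟨y, by simp [hy, hcon]⟩
  simp at hu hv
  exact hv.2 (hu.2.tail ⟨ha, hu.1, hv.1⟩)

theorem hamConn (G : SimpleGraph V) {a} (hα : AlphaLE G a) (W : Finset V) (hW : InSep G W (a + 1))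
    (x y : V) (hx : x ∈ W) (hy : y ∈ W) (hxy : x ≠ y) : ∃ l, PT G x y l ∧ ∀ v, v ∈ l ↔ v ∈ W := by
  obtain ⟨l, ⟨hp, hlW⟩, hmax⟩ := exists_max_nat (fun l : List V => l.length)
    (fun l => PT G x y l ∧ ∀ v ∈ l, v ∈ W) W.card ((hW.rch hx hy).exists_PT hy)
    (fun l h => nodup_length_le h.1.1 h.2)
  refine ⟨l, hp, fun v => ⟨hlW v, fun hv => ?_⟩⟩
  by_contra hvl
  set D := W.filter (fun u => u ∉ l ∧ Rch G (W \ l.toFinset) v u) with hD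
  have hDl : ∀ u ∈ D, u ∈ W \ l.toFinset := by intro u hu; simp [hD] at hu; simp [hu]
  have conn : ∀ u ∈ D, ∀ w ∈ D, ∃ d, PT G u w d ∧ ∀ z ∈ d, z ∈ W \ l.toFinset := by
    intro u hu w hw
    have h1 : Rch G (W \ l.toFinset) v u := by rw [hD, mem_filter] at hu; exact hu.2.2
    have h2 : Rch G (W \ l.toFinset) v w := by rw [hD, mem_filter] at hw; exact hw.2.2
    exact Rch.exists_PT (h1.symm.trans h2) (hDl w hw)
  set At := l.toFinset.filter (fun u => ∃ w ∈ D, G.Adj u w) with hAt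
  have hAtm : ∀ u, u ∈ At ↔ u ∈ l ∧ ∃ w ∈ D, G.Adj u w := by intro u; simp [hAt]
  have long : ∀ l' d, PT G x y l' → d ≠ [] → (∀ z ∈ d, z ∈ W \ l.toFinset) → l'.Perm (d ++ l) → False := by
    intro l' d h1 h2 h3 h4
    have h5 := hmax l' ⟨h1, fun z hz => by
      have := h4.subset hz
      simp at this
      rcases this with h | h
      · have := h3 z h; simp at this; exact this.1
      · exact hlW z h⟩
    have h6 := h4.length_eq
    simp at h6
    have : 0 < d.length := List.length_pos_iff.2 h2
    omega
  have nocons : ∀ u w, Nx l u w → u ∈ At → w ∈ At → False := by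
    rintro u w ⟨A, B, e⟩ hu hw
    obtain ⟨-, u', hu', au⟩ := (hAtm u).1 hu
    obtain ⟨-, w', hw', aw⟩ := (hAtm w).1 hw
    obtain ⟨d, hd, hdW⟩ := conn u' hu' w' hw'
    have e' : l = (A ++ [u]) ++ (w :: B) := by simp [e]
    have hp' := hp
    rw [e'] at hp'
    obtain ⟨u1, w1, h1, h2, -, h3⟩ := hp'.split (by simp) (by simp)
    have e1 : u1 = u := by have := h1.2.2.2; simp at this; exact this.symm
    have e2 : w1 = w := by have := h2.2.2.1; simp at this; exact this.symm
    rw [e1] at h1; rw [e2] at h2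
    have hdl : ∀ z ∈ d, z ∉ l := fun z hz => by have := hdW z hz; simp at this; exact this.2
    refine long ((A ++ [u]) ++ (d ++ (w :: B))) d ?_ hd.ne_nil hdW ?_
    · refine h1.append (hd.append h2 aw.symm ?_) au ?_
      · intro z hz hz'; exact hdl z hz (by rw [e']; exact List.mem_append_right _ hz')
      · intro z hz hz'
        rcases List.mem_append.1 hz' with h | h
        · exact hdl z h (by rw [e']; exact List.mem_append_left _ hz)
        · exact h3 z hz h
    · rw [e', List.perm_iff_count]; intro b; simp [List.count_cons]; omega
  have hAtc : a + 2 ≤ At.card := by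
    by_contra hcon
    obtain ⟨s1, hs1⟩ := Nx.exists hp hp.head_mem hxy
    have hrest : ((W \ At) \ D).Nonempty := by
      have hlm : ∀ u ∈ l, u ∉ At → u ∈ (W \ At) \ D := by
        intro u hu hu'
        simp only [mem_sdiff]
        refine ⟨⟨hlW u hu, hu'⟩, fun h => ?_⟩
        have := hDl u h; simp at this; exact this.2 hu
      by_cases h : x ∈ At
      · exact ⟨s1, hlm s1 hs1.mem_right fun h' => nocons x s1 hs1 h h'⟩
      · exact ⟨x, hlm x hp.head_mem h⟩
    have hDAt : D ⊆ W \ At := by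
      intro u hu
      have := hDl u hu
      simp at this
      simp only [mem_sdiff]
      exact ⟨this.1, fun h => this.2 ((hAtm u).1 h).1⟩
    have hvD : v ∈ D := by
      simp [hD, hv, hvl]; exact Relation.ReflTransGen.refl
    obtain ⟨u, hu, w, hw, ha⟩ := hW At (fun u hu => hlW u ((hAtm u).1 hu).1) (by omega) D ((W \ At) \ D)
      (union_sdiff_of_subset hDAt) disjoint_sdiff ⟨v, hvD⟩ hrest
    simp only [mem_sdiff] at hw
    by_cases hwl : w ∈ l
    · exact hw.1.2 ((hAtm w).2 ⟨hwl, u, hu, ha.symm⟩)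
    · apply hw.2
      have hu2 := hDl u hu
      rw [hD, mem_filter] at hu ⊢
      exact ⟨hw.1.1, hwl, hu.2.2.tail ⟨ha, hu2, by simp [hw.1.1, hwl]⟩⟩
  obtain ⟨s, hs, hinj⟩ := hp.exists_succ
  have hRc : a < (At.erase y).card := by
    have : At.card - 1 ≤ (At.erase y).card := pred_card_le_card_erase
    omega
  have hRl : ∀ u ∈ At.erase y, u ∈ l ∧ u ≠ y ∧ ∃ w ∈ D, G.Adj u w := by
    intro u hu
    rw [mem_erase, hAtm] at hu; tauto
  obtain ⟨u', hu', v', hv', hadj⟩ := hα.exists_adj ((At.erase y).image s) (by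
    rw [card_image_of_injOn]
    · exact hRc
    · intro u hu v hv e
      exact hinj u (hRl u hu).1 (hRl u hu).2.1 v (hRl v hv).1 (hRl v hv).2.1 e)
  obtain ⟨u, hu, rfl⟩ := mem_image.1 hu'
  obtain ⟨w, hw, rfl⟩ := mem_image.1 hv'
  have huw : u ≠ w := by rintro rfl; exact G.loopless.irrefl _ hadj
  obtain ⟨hu1, hu2, u', hu3, au⟩ := hRl u hu
  obtain ⟨hw1, hw2, w', hw3, aw⟩ := hRl w hw
  obtain ⟨d, hd, hdW⟩ := conn u' hu3 w' hw3
  obtain ⟨l', h1, h2⟩ := hp.surgery1 (hs u hu1 hu2) (hs w hw1 hw2) huw hadj hd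
    (fun z hz => by have := hdW z hz; simp at this; exact this.2) au aw.symm
  exact long l' d h1 hd.ne_nil hdW h2

structure Dec (G : SimpleGraph V) (a : ℕ) (X : Finset V) (P : Finset (Finset V)) : Prop where
  ne : ∀ A ∈ P, A.Nonempty
  disj : ∀ A ∈ P, ∀ B ∈ P, A ≠ B → ∀ u ∈ A, ∀ v ∈ B, u ≠ v ∧ ¬ G.Adj u v
  cover : ∀ v, v ∈ X ∨ ∃ A ∈ P, v ∈ A
  disjX : ∀ A ∈ P, ∀ v ∈ A, v ∉ X
  card : X.card + (a + 1) ≤ P.card * (a + 1)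

theorem Dec.card_le {G : SimpleGraph V} {a X P} (h : Dec G a X P) (hα : AlphaLE G a) : P.card ≤ a := by
  have : ∀ A, ∃ v, A ∈ P → v ∈ A := by
    intro A
    by_cases hA : A ∈ P
    · obtain ⟨v, hv⟩ := h.ne A hA
      exact ⟨v, fun _ => hv⟩
    · have : Nonempty V := by
        have := h.card
        rcases P.eq_empty_or_nonempty with hP | ⟨B, hB⟩
        · subst hP; simp at this
        · obtain ⟨v, -⟩ := h.ne B hB; exact ⟨v⟩
      obtain ⟨v⟩ := this
      exact ⟨v, fun h => absurd h hA⟩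
  choose f hf using this
  have hinj : Set.InjOn f P := by
    intro A hA B hB e
    by_contra hne
    exact (h.disj A hA B hB hne _ (hf A hA) _ (hf B hB)).1 e
  rw [← card_image_of_injOn hinj]
  apply hα
  intro u hu v hv
  obtain ⟨A, hA, rfl⟩ := mem_image.1 hu
  obtain ⟨B, hB, rfl⟩ := mem_image.1 hv
  by_cases e : A = B
  · subst e; simp
  · exact (h.disj A hA B hB e _ (hf A hA) _ (hf B hB)).2

theorem exists_dec [Fintype V] [Nonempty V] (G : SimpleGraph V) {a} (hα : AlphaLE G a) :
    ∃ X P, Dec G a X P ∧ ∀ A ∈ P, InSep G A (a + 1) := by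
  obtain ⟨⟨X, P⟩, hD, hmax⟩ := exists_max_nat (fun q : Finset V × Finset (Finset V) => q.2.card)
    (fun q => Dec G a q.1 q.2) a ⟨(∅, {univ}), by
      refine ⟨?_, ?_, ?_, ?_, ?_⟩ <;> simp⟩ (fun q h => h.card_le hα)
  refine ⟨X, P, hD, ?_⟩
  simp only at hD hmax
  intro W hW Y hY hYc A B hAB hdis hA hB
  by_contra hcon
  push Not at hcon
  have hAW : ∀ v ∈ A, v ∈ W ∧ v ∉ Y := fun v hv => by
    have : v ∈ W \ Y := hAB ▸ mem_union_left _ hv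
    simpa using this
  have hBW : ∀ v ∈ B, v ∈ W ∧ v ∉ Y := fun v hv => by
    have : v ∈ W \ Y := hAB ▸ mem_union_right _ hv
    simpa using this
  have hABne : A ≠ B := by
    rintro rfl
    obtain ⟨v, hv⟩ := hA
    exact disjoint_left.1 hdis hv hv
  have hAP : A ∉ P.erase W := by
    intro h
    rw [mem_erase] at h
    obtain ⟨v, hv⟩ := hA
    exact (hD.disj A h.2 W hW h.1 v hv v (hAW v hv).1).1 rfl
  have hBP : B ∉ P.erase W := by
    intro h
    rw [mem_erase] at h
    obtain ⟨v, hv⟩ := hB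
    exact (hD.disj B h.2 W hW h.1 v hv v (hBW v hv).1).1 rfl
  have hc : (insert A (insert B (P.erase W))).card = P.card + 1 := by
    rw [card_insert_of_notMem (by simp only [mem_insert]; push Not; exact ⟨hABne, hAP⟩), card_insert_of_notMem hBP]
    have := card_erase_add_one hW
    omega
  have hABadj : ∀ u ∈ A, ∀ v ∈ B, u ≠ v ∧ ¬ G.Adj u v := fun u hu v hv =>
    ⟨fun e => disjoint_left.1 hdis hu (e ▸ hv), hcon u hu v hv⟩
  have hsymm : ∀ S T : Finset V, (∀ u ∈ S, ∀ v ∈ T, u ≠ v ∧ ¬ G.Adj u v) →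
      (∀ u ∈ T, ∀ v ∈ S, u ≠ v ∧ ¬ G.Adj u v) := fun S T h u hu v hv =>
    ⟨(h v hv u hu).1.symm, fun h' => (h v hv u hu).2 h'.symm⟩
  have hother : ∀ S ∈ P.erase W, ∀ T ⊆ W, ∀ u ∈ S, ∀ v ∈ T, u ≠ v ∧ ¬ G.Adj u v := by
    intro S hS T hT u hu v hv
    rw [mem_erase] at hS
    exact hD.disj S hS.2 W hW hS.1 u hu v (hT hv)
  have := hmax (X ∪ Y, insert A (insert B (P.erase W))) ⟨?_, ?_, ?_, ?_, ?_⟩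
  · simp only at this; omega
  · intro S hS
    simp only [mem_insert, mem_erase] at hS
    rcases hS with rfl | rfl | hS
    · exact hA
    · exact hB
    · exact hD.ne S hS.2
  · intro S hS T hT hST
    simp only [mem_insert] at hS hT
    have hAW' : A ⊆ W := fun v hv => (hAW v hv).1
    have hBW' : B ⊆ W := fun v hv => (hBW v hv).1
    rcases hS with hS | hS | hS <;> rcases hT with hT | hT | hT
    · exact absurd (hS.trans hT.symm) hST
    · subst hS hT; exact hABadj
    · subst hS; exact hsymm _ _ (hother T hT _ hAW')
    · subst hS hT; exact hsymm _ _ hABadj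
    · exact absurd (hS.trans hT.symm) hST
    · subst hS; exact hsymm _ _ (hother T hT _ hBW')
    · subst hT; exact hother S hS _ hAW'
    · subst hT; exact hother S hS _ hBW'
    · exact hD.disj S (mem_of_mem_erase hS) T (mem_of_mem_erase hT) hST
  · intro v
    simp only [mem_union, mem_insert, mem_erase]
    rcases hD.cover v with h | ⟨S, hS, hv⟩
    · exact Or.inl (Or.inl h)
    · by_cases e : S = W
      · subst e
        by_cases hvY : v ∈ Y
        · exact Or.inl (Or.inr hvY)
        · have : v ∈ A ∪ B := by rw [hAB]; simp [hv, hvY]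
          rcases mem_union.1 this with h | h
          · exact Or.inr ⟨A, Or.inl rfl, h⟩
          · exact Or.inr ⟨B, Or.inr (Or.inl rfl), h⟩
      · exact Or.inr ⟨S, Or.inr (Or.inr ⟨e, hS⟩), hv⟩
  · intro S hS v hv
    simp only [mem_insert, mem_erase] at hS
    simp only [mem_union, not_or]
    rcases hS with rfl | rfl | hS
    · exact ⟨hD.disjX W hW v (hAW v hv).1, (hAW v hv).2⟩
    · exact ⟨hD.disjX W hW v (hBW v hv).1, (hBW v hv).2⟩
    · exact ⟨hD.disjX S hS.2 v hv, fun h => (hD.disj S hS.2 W hW hS.1 v hv v (hY h)).1 rfl⟩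
  · simp only
    rw [hc]
    have := hD.card
    have h2 := card_union_le X Y
    have : (P.card + 1) * (a + 1) = P.card * (a + 1) + (a + 1) := by ring
    omega

end

-- H1
section
open Classical Finset

variable {V : Type*}

theorem CL.chain {G : SimpleGraph V} {l} (h : CL G l) : l.IsChain G.Adj := by
  obtain ⟨_, _, _, hp, _⟩ := h; exact hp.2.1
theorem CL.nodup {G : SimpleGraph V} {l} (h : CL G l) : l.Nodup := by
  obtain ⟨_, _, _, hp, _⟩ := h; exact hp.1
theorem CL.close {G : SimpleGraph V} {x l y} (h : CL G (x :: (l ++ [y]))) : G.Adj y x := by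
  obtain ⟨_, u, v, hp, ha⟩ := h
  have h1 : u = x := by have := hp.2.2.1; simp at this; exact this.symm
  have h2 : v = y := by
    have := hp.2.2.2
    have h3 : (x :: (l ++ [y])).getLast? = some y := by
      rw [← List.cons_append]; exact List.getLast?_concat
    rw [h3] at this
    exact (Option.some.inj this).symm
  rw [← h1, ← h2]; exact ha

theorem cyc_lemma (F : SimpleGraph V) (I : Finset V) (t : V → Prop)
    (ht : ∀ x y, t x → t y → x = y)
    (hF : ∀ u v, F.Adj u v → (u ∈ I ∧ v ∉ I) ∨ (u ∉ I ∧ v ∈ I))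
    (h4 : ∀ i u j w, CL F [i, u, j, w] → i ∈ I → j ∈ I → t i → False)
    (l : List V) (hl : CL F l) :
    ∃ v1 u1 v2 rest, CL F (v1 :: u1 :: v2 :: rest) ∧ rest ≠ [] ∧ v1 ∈ I ∧ v2 ∈ I ∧ ¬ t v1 ∧ ¬ t v2 := by
  obtain ⟨i1, l1, hl1, hi1⟩ : ∃ i1 l1, CL F (i1 :: l1) ∧ i1 ∈ I := by
    match l, hl with
    | [], hl => simp [CL] at hl
    | [x], hl => simp [CL] at hl
    | x :: y :: l, hl =>
      have := (List.isChain_cons_cons.1 hl.chain).1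
      rcases hF x y this with h | h
      · exact ⟨x, _, hl, h.1⟩
      · exact ⟨y, l ++ [x], CL.rotate (A := [x]) hl, h.2⟩
  clear hl l
  match l1, hl1 with
  | [], hl => simp [CL] at hl
  | [u], hl => simp [CL] at hl
  | [u, i], hl =>
    have h1 := hF _ _ (List.isChain_cons_cons.1 hl.chain).1
    have h2 := hF _ _ (List.isChain_cons_cons.1 (List.isChain_cons_cons.1 hl.chain).2).1
    have h3 := hF _ _ (CL.close (l := [u]) hl)
    tauto
  | u1 :: i2 :: u2 :: rest, hl =>
    have c1 := (List.isChain_cons_cons.1 hl.chain)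
    have c2 := (List.isChain_cons_cons.1 c1.2)
    have c3 := (List.isChain_cons_cons.1 c2.2)
    have hi2 : i2 ∈ I := by
      have h1 := hF _ _ c1.1
      have h2 := hF _ _ c2.1
      tauto
    have hnd := hl.nodup
    have hu1 : u1 ∉ I := by have h1 := hF _ _ c1.1; tauto
    have hu2 : u2 ∉ I := by have h1 := hF _ _ c3.1; tauto
    by_cases t1 : t i1
    · match rest, hl, c3, hnd with
      | [], hl, _, _ => exact (h4 _ _ _ _ hl hi1 hi2 t1).elim
      | i3 :: rest, hl, c3, hnd =>
        have c4 := (List.isChain_cons_cons.1 c3.2)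
        have hi3 : i3 ∈ I := by have h1 := hF _ _ c4.1; tauto
        simp at hnd
        refine ⟨i2, u2, i3, rest ++ [i1, u1], CL.rotate (A := [i1, u1]) hl, by simp, hi2, hi3, ?_, ?_⟩
        · intro h; have := ht _ _ t1 h; tauto
        · intro h; have := ht _ _ t1 h; tauto
    by_cases t2 : t i2
    · match rest, hl, c3, hnd with
      | [], hl, _, _ => exact (h4 i2 u2 i1 u1 (CL.rotate (A := [i1, u1]) hl) hi2 hi1 t2).elim
      | [i3], hl, c3, _ =>
        have c4 := (List.isChain_cons_cons.1 c3.2)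
        have h5 := hF _ _ c4.1
        have h6 := hF _ _ (CL.close (l := [u1, i2, u2]) hl)
        tauto
      | [i3, u3], hl, c3, hnd =>
        have c4 := (List.isChain_cons_cons.1 c3.2)
        have hi3 : i3 ∈ I := by have h1 := hF _ _ c4.1; tauto
        simp at hnd
        refine ⟨i3, u3, i1, [u1, i2, u2], CL.rotate (A := [i1, u1, i2, u2]) hl, by simp, hi3, hi1, ?_, t1⟩
        · intro h; have := ht _ _ t2 h; tauto
      | i3 :: u3 :: i4 :: rest, hl, c3, hnd =>
        have c4 := (List.isChain_cons_cons.1 c3.2)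
        have c5 := (List.isChain_cons_cons.1 c4.2)
        have c6 := (List.isChain_cons_cons.1 c5.2)
        have hi3 : i3 ∈ I := by have h1 := hF _ _ c4.1; tauto
        have hi4 : i4 ∈ I := by have h1 := hF _ _ c5.1; have h2 := hF _ _ c6.1; tauto
        simp at hnd
        refine ⟨i3, u3, i4, rest ++ [i1, u1, i2, u2], CL.rotate (A := [i1, u1, i2, u2]) hl, by simp, hi3, hi4, ?_, ?_⟩
        · intro h; have := ht _ _ t2 h; tauto
        · intro h; have := ht _ _ t2 h; tauto
    exact ⟨i1, u1, i2, u2 :: rest, hl, by simp, hi1, hi2, t1, t2⟩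

theorem ham_interior (G : SimpleGraph V) {a} (hα : AlphaLE G a) (W : Finset V) (hW : InSep G W (a + 1))
    (x y : V) (hx : x ∈ W) (hy : y ∈ W) (hxy : x ≠ y) (h3 : 3 ≤ W.card) :
    ∃ M h t, PT G h t M ∧ G.Adj x h ∧ G.Adj t y ∧ ∀ v, v ∈ M ↔ v ∈ W ∧ v ≠ x ∧ v ≠ y := by
  obtain ⟨l, hp, hl⟩ := hamConn G hα W hW x y hx hy hxy
  have hlen : 3 ≤ l.length := by
    have : l.toFinset = W := by ext v; simp [hl]
    rw [← this, List.toFinset_card_of_nodup hp.1] at h3; exact h3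
  obtain ⟨M, rfl⟩ : ∃ M, l = [x] ++ (M ++ [y]) := by
    match l, hp with
    | [], hp => exact absurd rfl hp.ne_nil
    | z :: l, hp =>
      have e : z = x := by have := hp.2.2.1; simpa using this
      subst e
      have hne : l ≠ [] := by rintro rfl; simp at hlen
      have e2 : l.getLast hne = y := by
        have := hp.2.2.2
        rw [List.getLast?_cons_of_ne_nil hne, List.getLast?_eq_some_getLast hne] at this
        simpa using this
      refine ⟨l.dropLast, ?_⟩
      have := List.dropLast_append_getLast hne
      rw [e2] at this
      simp [this]
  have hM : M ≠ [] := by rintro rfl; simp at hlen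
  obtain ⟨u, v, h1, h2, h4, h5⟩ := hp.split (by simp) (by simp)
  obtain ⟨u', v', h6, h7, h8, h9⟩ := h2.split hM (by simp)
  have e1 : u = x := by have := h1.2.2.2; simp at this; exact this.symm
  have e2 : v' = y := by have := h7.2.2.1; simp at this; exact this.symm
  have e3 : v = v := rfl
  subst e1 e2
  have hnd := hp.1
  simp at hnd h5
  refine ⟨M, v, u', h6, h4, h8, ?_⟩
  intro w
  rw [← hl]
  simp
  constructor
  · intro hw
    refine ⟨Or.inr (Or.inl hw), ?_, ?_⟩
    · rintro rfl; tauto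
    · rintro rfl; have := h9 w hw; simp at this
  · tauto

theorem PT.interior {G : SimpleGraph V} {x y l} (hp : PT G x y l) {w} (hw : w ∈ l) (hx : w ≠ x)
    (hy : w ≠ y) : ∃ a b, a ∈ l ∧ b ∈ l ∧ a ≠ b ∧ G.Adj a w ∧ G.Adj w b := by
  obtain ⟨s, hs⟩ := Nx.exists hp hw hy
  obtain ⟨s', hs'⟩ := Nx.exists hp.reverse (by simpa using hw) hx
  have hs'' : Nx l s' w := by
    obtain ⟨A, D, e⟩ := hs'
    refine ⟨D.reverse, A.reverse, ?_⟩
    have := congrArg List.reverse e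
    simpa using this
  refine ⟨s', s, hs''.mem_left, hs.mem_right, ?_, hs''.adj hp, hs.adj hp⟩
  rintro rfl
  -- s' followed by w and w followed by s'
  obtain ⟨A, D, e⟩ := hs''
  have h1 : Nx l w s' := hs
  rw [e] at h1 hp
  have hnd := hp.1
  match D with
  | [] =>
    exact h1.ne_last hp (by have := hp.2.2.2; simpa using this)
  | d :: D =>
    have h2 : Nx (A ++ s' :: w :: d :: D) w d := ⟨A ++ [s'], D, by simp⟩
    have := Nx.uniq hnd h1 h2
    subst this
    simp [List.nodup_append] at hnd

def FI (G : SimpleGraph V) (I : Finset V) : SimpleGraph V where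
  Adj u v := G.Adj u v ∧ (u ∈ I ∨ v ∈ I)
  symm := ⟨fun _ _ h => ⟨h.1.symm, h.2.symm⟩⟩
  loopless := ⟨fun _ h => G.loopless.irrefl _ h.1⟩

theorem PT.monoFI {G : SimpleGraph V} {I x y l} (h : PT (FI G I) x y l) : PT G x y l :=
  ⟨h.1, h.2.1.imp fun _ _ h => h.1, h.2.2⟩

set_option maxHeartbeats 4000000 in
theorem acyclic_core [Fintype V] (G : SimpleGraph V) (a m : ℕ) (hα : AlphaLE G a)
    (hcirc : ∀ l, CL G l → l.length + 1 ≤ m)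
    (hbc : ∀ x y, x ≠ y → ¬ G.Adj x y → m + 1 ≤ (cn G {x, y}).card)
    (X : Finset V) (B : Finset (Finset V)) (att : Finset V → Finset V) (f : Finset V → V)
    (hBX : ∀ P ∈ B, ∀ v ∈ P, v ∉ X)
    (hBB : ∀ P ∈ B, ∀ Q ∈ B, P ≠ Q → ∀ u ∈ P, ∀ v ∈ Q, u ≠ v)
    (hattX : ∀ P ∈ B, att P ⊆ X)
    (hsep : ∀ P ∈ B, ∀ S ⊆ att P, InSep G (P ∪ S) (a + 1))
    (hcard : ∀ P ∈ B, 3 ≤ P.card)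
    (hf : ∀ P ∈ B, f P ∈ P) (hfN : ∀ P ∈ B, ∀ w, G.Adj (f P) w → w ∈ P ∪ att P)
    (t : V → Prop) (ht : ∀ x y, t x → t y → x = y)
    (htQ : ∀ x, t x → ∀ P ∈ B, x ∉ P ∪ att P)
    (htN : ∀ x, t x → ∀ P ∈ B, ∀ u ∈ P ∪ att P, ∀ v ∈ P ∪ att P, G.Adj x u → G.Adj x v → u = v)
    (I : Finset V) (hI : Ind G I) (hIf : ∀ i ∈ I, (∃ P ∈ B, i = f P) ∨ t i)
    (l : List V) (hl : CL (FI G I) l) : False := by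
  have hF : ∀ u v, (FI G I).Adj u v → (u ∈ I ∧ v ∉ I) ∨ (u ∉ I ∧ v ∈ I) := by
    intro u v h
    have h1 := h.2
    by_cases hu : u ∈ I <;> by_cases hv : v ∈ I
    · exact absurd h.1 (hI u hu v hv)
    · exact Or.inl ⟨hu, hv⟩
    · exact Or.inr ⟨hu, hv⟩
    · tauto
  obtain ⟨v1, u1, v2, rest, hC, hrest, hv1, hv2, tv1, tv2⟩ := cyc_lemma (FI G I) I t ht hF (by
    intro i u j w hc hi hj ti
    have c1 := (List.isChain_cons_cons.1 hc.chain)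
    have c2 := (List.isChain_cons_cons.1 c1.2)
    have c3 := (List.isChain_cons_cons.1 c2.2)
    have c4 := CL.close (l := [u, j]) hc
    have hnd := hc.nodup
    simp at hnd
    rcases hIf j hj with ⟨P, hP, e⟩ | tj
    · have h1 := hfN P hP u (e ▸ c2.1.1.symm)
      have h2 := hfN P hP w (e ▸ c3.1.1)
      have := htN i ti P hP u h1 w h2 c1.1.1 c4.1.symm
      tauto
    · have := ht _ _ ti tj; tauto) l hl
  clear hl l
  obtain ⟨P1, hP1, e1⟩ := (hIf v1 hv1).resolve_right tv1
  obtain ⟨P2, hP2, e2⟩ := (hIf v2 hv2).resolve_right tv2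
  have hnd := hC.nodup
  have c1 := (List.isChain_cons_cons.1 hC.chain)
  have c2 := (List.isChain_cons_cons.1 c1.2)
  have hv12 : v1 ≠ v2 := by simp at hnd; tauto
  have hP12 : P1 ≠ P2 := by rintro rfl; exact hv12 (e1.trans e2.symm)
  obtain ⟨_, x, y, hpt, hyx⟩ := hC
  have hx : x = v1 := by have := hpt.2.2.1; simp at this; exact this.symm
  subst hx
  have hpt' : PT (FI G I) x y ([x, u1, v2] ++ rest) := hpt
  obtain ⟨b, u2, h1, hptr, h3, hdis⟩ := hpt'.split (by simp) hrest
  have hb : b = v2 := by have := h1.2.2.2; simp at this; exact this.symm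
  subst hb
  simp at hdis
  have hxP : x ∈ P1 := e1 ▸ hf P1 hP1
  have hbP : b ∈ P2 := e2 ▸ hf P2 hP2
  have hNx : ∀ w, G.Adj x w → w ∈ P1 ∪ att P1 := fun w h => hfN P1 hP1 w (e1 ▸ h)
  have hNb : ∀ w, G.Adj b w → w ∈ P2 ∪ att P2 := fun w h => hfN P2 hP2 w (e2 ▸ h)
  have hu1P1 := hNx u1 c1.1.1
  have hu1P2 := hNb u1 c2.1.1.symm
  have hPX1 : ∀ v ∈ P1, v ∉ P2 ∪ att P2 := by
    intro v hv h
    rcases mem_union.1 h with h | h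
    · exact hBB P1 hP1 P2 hP2 hP12 v hv v h rfl
    · exact hBX P1 hP1 v hv (hattX P2 hP2 h)
  have hPX2 : ∀ v ∈ P2, v ∉ P1 ∪ att P1 := by
    intro v hv h
    rcases mem_union.1 h with h | h
    · exact hBB P1 hP1 P2 hP2 hP12 v h v hv rfl
    · exact hBX P2 hP2 v hv (hattX P1 hP1 h)
  have hu1a1 : u1 ∈ att P1 := (mem_union.1 hu1P1).resolve_left fun h => hPX1 u1 h hu1P2
  have hu1a2 : u1 ∈ att P2 := (mem_union.1 hu1P2).resolve_left fun h => hPX2 u1 h hu1P1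
  have hyP1 : y ∈ P1 ∪ att P1 := hNx y hyx.1.symm
  have hu2P2 : u2 ∈ P2 ∪ att P2 := hNb u2 h3.1
  have hymem : y ∈ rest := hptr.last_mem
  have hu2mem : u2 ∈ rest := hptr.head_mem
  have hu1r : u1 ∉ rest := hdis.2.1
  -- local structure of rest
  have loc : ∀ L x' y' w P, PT (FI G I) x' y' L → w ∈ L → w ≠ x' → w ≠ y' → P ∈ B → w ∈ P →
      w ∉ I → f P ∉ L → False := by
    intro L x' y' w P hL hw hwx hwy hP hwP hwI hfL
    obtain ⟨c, d, hc, hd, hcd, a1, a2⟩ := hL.interior hw hwx hwy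
    have hcI : c ∈ I := (hF _ _ a1).elim (fun h => h.1) (fun h => absurd h.2 hwI)
    have hdI : d ∈ I := (hF _ _ a2).elim (fun h => absurd h.1 hwI) (fun h => h.2)
    have aux : ∀ i ∈ I, i ∈ L → G.Adj i w → t i := by
      intro i hi hiL hiw
      rcases hIf i hi with ⟨Q, hQ, e⟩ | h
      · exfalso
        have h5 := hfN Q hQ w (e ▸ hiw)
        by_cases hPQ : P = Q
        · subst hPQ; exact hfL (e ▸ hiL)
        · rcases mem_union.1 h5 with h | h
          · exact hBB P hP Q hQ hPQ w hwP w h rfl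
          · exact hBX P hP w hwP (hattX Q hQ h)
      · exact h
    exact hcd (ht _ _ (aux c hcI hc a1.1) (aux d hdI hd a2.1.symm))
  have Imem : ∀ w ∈ I, ∀ P ∈ B, w ∈ P → w = f P := by
    intro w hw P hP hwP
    rcases hIf w hw with ⟨Q, hQ, e⟩ | h
    · by_cases hPQ : P = Q
      · subst hPQ; exact e
      · exact absurd rfl (hBB P hP Q hQ hPQ w hwP w (e ▸ hf Q hQ))
    · exact absurd (mem_union_left _ hwP) (htQ w h P hP)
  have hr1 : ∀ w ∈ rest, w ∈ P1 → w = y := by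
    intro w hw hwP
    by_contra hne
    have hwI : w ∉ I := by
      intro h
      have := Imem w h P1 hP1 hwP
      rw [← e1] at this
      exact hdis.1 (this ▸ hw)
    refine loc (b :: rest) b y w P1 (hptr.cons h3 hdis.2.2) (by simp [hw]) ?_ hne hP1 hwP hwI ?_
    · rintro rfl; exact hdis.2.2 hw
    · rw [← e1]; simp; exact ⟨hv12, hdis.1⟩
  have hr2 : ∀ w ∈ rest, w ∈ P2 → w = u2 := by
    intro w hw hwP
    by_contra hne
    have hwI : w ∉ I := by
      intro h
      have := Imem w h P2 hP2 hwP
      rw [← e2] at this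
      exact hdis.2.2 (this ▸ hw)
    refine loc (rest ++ [x]) u2 x w P2 (hptr.append (PT.single _ x) hyx ?_) (by simp [hw]) hne ?_ hP2 hwP hwI ?_
    · intro v hv; simp; rintro rfl; exact hdis.1 hv
    · rintro rfl; exact hdis.1 hw
    · rw [← e2]; simp; exact ⟨hdis.2.2, Ne.symm hv12⟩
  set l := x :: u1 :: b :: rest with hldef
  set S1 := att P1 \ l.toFinset with hS1
  set S2 := (att P2 \ att P1) \ l.toFinset with hS2
  have hW1 : ∃ T ⊆ att P1, ∀ v, v ∈ P1 ∪ T ↔ (v ∈ P1 ∨ v ∈ S1 ∨ v = y ∨ v = u1) := by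
    refine ⟨(S1 ∪ {y, u1}) ∩ att P1, inter_subset_right, fun v => ?_⟩
    simp only [mem_union, mem_inter, mem_insert, mem_singleton]
    constructor
    · rintro (h | ⟨h | h, _⟩)
      · exact Or.inl h
      · exact Or.inr (Or.inl h)
      · exact Or.inr (Or.inr h)
    · rintro (h | h | rfl | rfl)
      · exact Or.inl h
      · exact Or.inr ⟨Or.inl h, (mem_sdiff.1 h).1⟩
      · rcases mem_union.1 hyP1 with h | h
        · exact Or.inl h
        · exact Or.inr ⟨Or.inr (Or.inl rfl), h⟩
      · exact Or.inr ⟨Or.inr (Or.inr rfl), hu1a1⟩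
  have hW2 : ∃ T ⊆ att P2, ∀ v, v ∈ P2 ∪ T ↔ (v ∈ P2 ∨ v ∈ S2 ∨ v = u1 ∨ v = u2) := by
    refine ⟨(S2 ∪ {u1, u2}) ∩ att P2, inter_subset_right, fun v => ?_⟩
    simp only [mem_union, mem_inter, mem_insert, mem_singleton]
    constructor
    · rintro (h | ⟨h | h, _⟩)
      · exact Or.inl h
      · exact Or.inr (Or.inl h)
      · exact Or.inr (Or.inr h)
    · rintro (h | h | rfl | rfl)
      · exact Or.inl h
      · exact Or.inr ⟨Or.inl h, (mem_sdiff.1 (mem_sdiff.1 h).1).1⟩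
      · exact Or.inr ⟨Or.inr (Or.inl rfl), hu1a2⟩
      · rcases mem_union.1 hu2P2 with h | h
        · exact Or.inl h
        · exact Or.inr ⟨Or.inr (Or.inr rfl), h⟩
  obtain ⟨T1, hT1, hT1m⟩ := hW1
  obtain ⟨T2, hT2, hT2m⟩ := hW2
  obtain ⟨M1, g1, s1, hM1, ha1, hb1, hM1m⟩ := ham_interior G hα (P1 ∪ T1) (hsep P1 hP1 T1 hT1) y u1
    ((hT1m y).2 (Or.inr (Or.inr (Or.inl rfl)))) ((hT1m u1).2 (Or.inr (Or.inr (Or.inr rfl)))) (by rintro rfl; exact hu1r hymem)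
    ((hcard P1 hP1).trans (card_le_card subset_union_left))
  obtain ⟨M2, g2, s2, hM2, ha2, hb2, hM2m⟩ := ham_interior G hα (P2 ∪ T2) (hsep P2 hP2 T2 hT2) u1 u2
    ((hT2m u1).2 (Or.inr (Or.inr (Or.inl rfl)))) ((hT2m u2).2 (Or.inr (Or.inr (Or.inr rfl)))) (by rintro rfl; exact hu1r hu2mem)
    ((hcard P2 hP2).trans (card_le_card subset_union_left))
  have hM1r : ∀ v ∈ M1, v ∉ rest := by
    intro v hv hvr
    rw [hM1m, hT1m] at hv
    obtain ⟨h | h | h | h, h5, h6⟩ := hv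
    · exact h5 (hr1 v hvr h)
    · exact (mem_sdiff.1 h).2 (by simp [hldef, hvr])
    · exact h5 h
    · exact h6 h
  have hM2r : ∀ v ∈ M2, v ∉ rest := by
    intro v hv hvr
    rw [hM2m, hT2m] at hv
    obtain ⟨h | h | h | h, h5, h6⟩ := hv
    · exact h6 (hr2 v hvr h)
    · exact (mem_sdiff.1 h).2 (by simp [hldef, hvr])
    · exact h5 h
    · exact h6 h
  have hM12 : ∀ v ∈ M1, v ∉ M2 := by
    intro v hv hv'
    have hv2 := hv'
    rw [hM1m, hT1m] at hv
    rw [hM2m, hT2m] at hv'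
    obtain ⟨h | h | h | h, h5, h6⟩ := hv'
    · have : v ∈ P1 ∪ att P1 := by
        obtain ⟨h' | h' | h' | h', _, _⟩ := hv
        · exact mem_union_left _ h'
        · exact mem_union_right _ (mem_sdiff.1 h').1
        · exact h' ▸ hyP1
        · exact absurd h' h5
      exact hPX2 v h this
    · have hvX : v ∈ att P2 ∧ v ∉ att P1 := mem_sdiff.1 (mem_sdiff.1 h).1
      obtain ⟨h' | h' | h' | h', _, _⟩ := hv
      · exact hPX1 v h' (mem_union_right _ hvX.1)
      · exact hvX.2 (mem_sdiff.1 h').1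
      · exact hM2r v hv2 (h' ▸ hymem)
      · exact h5 h'
    · exact h5 h
    · exact hM2r v hv2 (h ▸ hu2mem)
  have hcyc : PT G g1 y (M1 ++ ([u1] ++ (M2 ++ rest))) := by
    refine hM1.append ((PT.single G u1).append (hM2.append hptr.monoFI hb2 hM2r) ha2 ?_) hb1 ?_
    · intro v hv hv'
      simp at hv; subst hv
      rcases List.mem_append.1 hv' with h | h
      · rw [hM2m] at h; exact h.2.1 rfl
      · exact hu1r h
    · intro v hv hv'
      simp at hv'
      rcases hv' with rfl | h | h
      · rw [hM1m] at hv; exact hv.2.2 rfl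
      · exact hM12 v hv h
      · exact hM1r v hv h
  have hsub : cn G {x, b} ⊆ (M1 ++ ([u1] ++ (M2 ++ rest))).toFinset := by
    intro v hv
    have hvQ : v ∈ P1 ∪ att P1 ∨ v ∈ P2 ∪ att P2 := by
      simp only [cn, mem_filter, mem_univ, true_and, mem_insert, mem_singleton] at hv
      obtain ⟨s, rfl | rfl, rfl | h⟩ := hv
      · exact Or.inl (mem_union_left _ hxP)
      · exact Or.inl (hNx v h)
      · exact Or.inr (mem_union_left _ hbP)
      · exact Or.inr (hNb v h)
    have hlist : v ∈ l → v ∈ X → v = u1 ∨ v ∈ rest := by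
      intro h hX
      simp [hldef] at h
      rcases h with rfl | h | rfl | h
      · exact absurd hX (hBX P1 hP1 v hxP)
      · exact Or.inl h
      · exact absurd hX (hBX P2 hP2 v hbP)
      · exact Or.inr h
    simp only [List.mem_toFinset, List.mem_append, List.mem_singleton]
    by_cases k1 : v = u1
    · exact Or.inr (Or.inl k1)
    by_cases k2 : v ∈ rest
    · exact Or.inr (Or.inr (Or.inr k2))
    have k3 : v ≠ y := by rintro rfl; exact k2 hymem
    have k4 : v ≠ u2 := by rintro rfl; exact k2 hu2mem
    have k5 : v ∈ X → v ∉ l := fun h h' => (hlist h' h).elim k1 k2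
    have q1 : v ∈ att P1 → v ∈ S1 := fun h => by
      rw [hS1, mem_sdiff, List.mem_toFinset]; exact ⟨h, k5 (hattX P1 hP1 h)⟩
    have q2 : v ∈ att P2 → v ∉ att P1 → v ∈ S2 := fun h h' => by
      rw [hS2, mem_sdiff, mem_sdiff, List.mem_toFinset]; exact ⟨⟨h, h'⟩, k5 (hattX P2 hP2 h)⟩
    have z1 : (v ∈ P1 ∨ v ∈ S1) → v ∈ M1 := fun h => by
      rw [hM1m, hT1m]
      exact ⟨h.elim Or.inl (fun h => Or.inr (Or.inl h)), k3, k1⟩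
    have z2 : (v ∈ P2 ∨ v ∈ S2) → v ∈ M2 := fun h => by
      rw [hM2m, hT2m]
      exact ⟨h.elim Or.inl (fun h => Or.inr (Or.inl h)), k1, k4⟩
    rcases hvQ with h | h
    · rcases mem_union.1 h with h | h
      · exact Or.inl (z1 (Or.inl h))
      · exact Or.inl (z1 (Or.inr (q1 h)))
    · rcases mem_union.1 h with h | h
      · exact Or.inr (Or.inr (Or.inl (z2 (Or.inl h))))
      · by_cases h' : v ∈ att P1
        · exact Or.inl (z1 (Or.inr (q1 h')))
        · exact Or.inr (Or.inr (Or.inl (z2 (Or.inr (q2 h h')))))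
  have h5 := card_le_card hsub
  rw [List.toFinset_card_of_nodup hcyc.1] at h5
  have h6 := hbc x b hv12 (hI x hv1 b hv2)
  have hlen1 : 0 < M1.length := List.length_pos_iff.2 hM1.ne_nil
  have hlen2 : 0 < M2.length := List.length_pos_iff.2 hM2.ne_nil
  have h7 := hcirc _ ⟨by simp; omega, g1, y, hcyc, ha1⟩
  omega

end

-- H2
section
open Classical Finset

variable {V : Type*}

theorem clique_PT (G : SimpleGraph V) (T : Finset V) (hT : T.Nonempty)
    (hc : ∀ x ∈ T, ∀ y ∈ T, x ≠ y → G.Adj x y) :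
    ∃ x ∈ T, ∃ y ∈ T, ∃ l, PT G x y l ∧ (∀ v, v ∈ l ↔ v ∈ T) ∧ l.length = T.card := by
  have hne : T.toList ≠ [] := by
    intro h
    rw [Finset.toList_eq_nil] at h
    exact hT.ne_empty h
  refine ⟨T.toList.head hne, mem_toList.1 (List.head_mem hne), T.toList.getLast hne,
    mem_toList.1 (List.getLast_mem hne), T.toList, ⟨T.nodup_toList, ?_, List.head?_eq_some_head hne,
      List.getLast?_eq_some_getLast hne⟩, by simp, by simp⟩
  have h1 : T.toList.Pairwise G.Adj := by
    have := T.nodup_toList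
    refine List.Pairwise.imp_of_mem ?_ this
    intro a b ha hb hab
    exact hc a (by simpa using ha) b (by simpa using hb) hab
  exact h1.isChain

theorem clique_card_lt [Fintype V] (G : SimpleGraph V) (m : ℕ) (hm : 3 ≤ m)
    (hcirc : ∀ l, CL G l → l.length + 1 ≤ m) (T : Finset V)
    (hc : ∀ x ∈ T, ∀ y ∈ T, x ≠ y → G.Adj x y) : T.card + 1 ≤ m := by
  by_contra hcon
  have hT : T.Nonempty := by
    rw [← card_pos]; omega
  obtain ⟨x, hx, y, hy, l, hp, _, hl⟩ := clique_PT G T hT hc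
  have hxy : y ≠ x := by
    rintro rfl
    match l, hp, hl with
    | [], hp, hl => simp at hl; omega
    | [_], hp, hl => simp at hl; omega
    | u :: v :: r, hp, hl =>
      have h1 := hp.2.2.1
      simp at h1
      have h2 := hp.2.2.2
      rw [List.getLast?_cons_cons] at h2
      have h3 := List.mem_of_getLast? h2
      have h4 := hp.1
      rw [h1] at h4
      exact (List.nodup_cons.1 h4).1 h3
  have := hcirc l ⟨by omega, x, y, hp, hc y hy x hx hxy⟩
  omega

theorem ham_len {G : SimpleGraph V} {x y l} {W : Finset V} (h : PT G x y l)
    (hm : ∀ v, v ∈ l ↔ v ∈ W) : l.length = W.card := by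
  rw [← List.toFinset_card_of_nodup h.1]
  congr 1; ext v; simp [hm]

theorem struct1 [Fintype V] [Nonempty V] (G : SimpleGraph V) (a m : ℕ) (ha : 1 ≤ a) (hα : AlphaLE G a)
    (hm : 20 * a ^ 3 ≤ m)
    (hbc : ∀ x y, x ≠ y → ¬ G.Adj x y → m + 1 ≤ (cn G {x, y}).card) :
    ∃ (X : Finset V) (B : Finset (Finset V)) (att : Finset V → Finset V) (f : Finset V → V),
    (∀ P ∈ B, ∀ v ∈ P, v ∉ X) ∧
    (∀ P ∈ B, ∀ Q ∈ B, P ≠ Q → ∀ u ∈ P, ∀ v ∈ Q, u ≠ v ∧ ¬ G.Adj u v) ∧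
    (∀ P ∈ B, att P ⊆ X) ∧
    (∀ P ∈ B, ∀ S ⊆ att P, InSep G (P ∪ S) (a + 1)) ∧
    (∀ P ∈ B, 3 ≤ P.card) ∧ (∀ P ∈ B, a < P.card) ∧
    (∀ P ∈ B, f P ∈ P) ∧ (∀ P ∈ B, ∀ w, G.Adj (f P) w → w ∈ P ∪ att P) ∧
    (∀ x y, (∀ P ∈ B, x ∉ P ∪ att P) → (∀ P ∈ B, y ∉ P ∪ att P) → x ≠ y → G.Adj x y) := by
  obtain ⟨X, P, hD, hS⟩ := exists_dec G hα
  have hPa := hD.card_le hα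
  have hX : X.card ≤ a ^ 2 - 1 ∧ X.card + 1 ≤ a ^ 2 := by
    have h1 := hD.card
    have h2 : P.card * (a + 1) ≤ a * (a + 1) := Nat.mul_le_mul_right _ hPa
    have : a * (a + 1) = a ^ 2 + a := by ring
    omega
  set Θ := a ^ 2 * (a + 1) with hΘ
  have e2 : a ^ 2 ≤ a ^ 3 := Nat.pow_le_pow_right ha (by norm_num)
  have e1 : a ≤ a ^ 3 := by simpa using Nat.pow_le_pow_right ha (show 1 ≤ 3 by norm_num)
  have e0 : 1 ≤ a ^ 3 := Nat.one_le_pow _ _ ha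
  have eΘ : Θ = a ^ 3 + a ^ 2 := by rw [hΘ]; ring
  have f2 : a ≤ a ^ 2 := by nlinarith
  set B := P.filter (fun A => Θ < A.card) with hB
  have hBP : ∀ A ∈ B, A ∈ P := fun A h => (mem_filter.1 h).1
  have hBc : ∀ A ∈ B, Θ < A.card := fun A h => (mem_filter.1 h).2
  set att : Finset V → Finset V := fun A => X.filter (fun x => a + 2 ≤ (A.filter (G.Adj x)).card) with hatt
  set Sm := P.filter (fun A => ¬ Θ < A.card) with hSm
  have hSm1 : Sm.card ≤ 1 := by
    rw [card_le_one]
    intro A hA C hC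
    by_contra hne
    rw [hSm, mem_filter] at hA hC
    obtain ⟨x, hx⟩ := hD.ne A hA.1
    obtain ⟨y, hy⟩ := hD.ne C hC.1
    have h1 := hD.disj A hA.1 C hC.1 hne x hx y hy
    have h2 := hbc x y h1.1 h1.2
    have h3 : cn G {x, y} ⊆ A ∪ C ∪ X := by
      intro v hv
      simp only [cn, mem_filter, mem_univ, true_and, mem_insert, mem_singleton] at hv
      simp only [mem_union]
      rcases hD.cover v with h | ⟨E, hE, hvE⟩
      · exact Or.inr h
      · by_cases hEA : E = A
        · subst hEA; exact Or.inl (Or.inl hvE)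
        by_cases hEC : E = C
        · subst hEC; exact Or.inl (Or.inr hvE)
        exfalso
        obtain ⟨s, rfl | rfl, h⟩ := hv
        · have := hD.disj A hA.1 E hE (Ne.symm hEA) s hx v hvE
          rcases h with h | h
          · exact this.1 h.symm
          · exact this.2 h
        · have := hD.disj C hC.1 E hE (Ne.symm hEC) s hy v hvE
          rcases h with h | h
          · exact this.1 h.symm
          · exact this.2 h
    have h4 := card_le_card h3
    have h5 := card_union_le (A ∪ C) X
    have h6 := card_union_le A C
    omega
  have hSmU : (Sm.biUnion id).card ≤ Θ := by
    have := card_biUnion_le_card_mul Sm id Θ (fun A hA => by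
      have := (mem_filter.1 hA).2; simpa using this)
    calc _ ≤ Sm.card * Θ := this
      _ ≤ 1 * Θ := Nat.mul_le_mul_right _ hSm1
      _ = Θ := one_mul _
  have hf : ∀ A, ∃ v, A ∈ B → v ∈ A ∧ ∀ x ∈ X, x ∉ att A → ¬ G.Adj x v := by
    intro A
    by_cases hA : A ∈ B
    · have h1 : ((X \ att A).biUnion (fun x => A.filter (G.Adj x))).card ≤ (X \ att A).card * (a + 1) := by
        refine card_biUnion_le_card_mul _ _ _ ?_
        intro x hx
        rw [mem_sdiff] at hx
        by_contra hcon
        exact hx.2 (mem_filter.2 ⟨hx.1, by omega⟩)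
      have h2 : (X \ att A).card * (a + 1) ≤ a ^ 2 * (a + 1) :=
        Nat.mul_le_mul_right _ ((card_le_card sdiff_subset).trans (by omega))
      obtain ⟨v, hv, hv'⟩ := exists_mem_notMem_of_card_lt_card (h1.trans_lt (h2.trans_lt (hBc A hA)))
      refine ⟨v, fun _ => ⟨hv, fun x hx hxa hadj => hv' ?_⟩⟩
      rw [mem_biUnion]
      exact ⟨x, mem_sdiff.2 ⟨hx, hxa⟩, mem_filter.2 ⟨hv, hadj⟩⟩
    · exact ⟨Classical.arbitrary V, fun h => absurd h hA⟩
  choose f hf using hf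
  have hTb : ∀ x, (∀ A ∈ B, x ∉ A ∪ att A) → ∀ A ∈ B, (A.filter (G.Adj x)).card ≤ a + 1 := by
    intro x hx A hA
    rcases hD.cover x with h | ⟨E, hE, hxE⟩
    · by_contra hcon
      exact hx A hA (mem_union_right _ (mem_filter.2 ⟨h, by omega⟩))
    · have hEA : E ≠ A := by
        rintro rfl; exact hx _ hA (mem_union_left _ hxE)
      have : A.filter (G.Adj x) = ∅ := by
        rw [filter_eq_empty_iff]
        intro v hv
        exact (hD.disj E hE A (hBP A hA) hEA x hxE v hv).2
      rw [this]; simp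
  refine ⟨X, B, att, f, fun A hA => hD.disjX A (hBP A hA),
    fun A hA C hC => hD.disj A (hBP A hA) C (hBP C hC), fun A hA => filter_subset _ _, ?_, ?_, ?_,
    fun A hA => (hf A hA).1, ?_, ?_⟩
  · intro A hA S hSA
    refine (hS A (hBP A hA)).union S ?_ ?_
    · intro x hx h
      exact hD.disjX A (hBP A hA) x h (mem_filter.1 (hSA hx)).1
    · intro x hx
      exact (mem_filter.1 (hSA hx)).2
  · intro A hA
    have := hBc A hA
    have : 1 ≤ a ^ 2 := Nat.one_le_pow _ _ ha
    omega
  · intro A hA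
    have := hBc A hA
    omega
  · intro A hA w hw
    rcases hD.cover w with h | ⟨E, hE, hwE⟩
    · by_contra hcon
      exact (hf A hA).2 w h (fun h => hcon (mem_union_right _ h)) hw.symm
    · by_cases hEA : A = E
      · subst hEA; exact mem_union_left _ hwE
      · exact absurd hw (hD.disj A (hBP A hA) E hE hEA _ (hf A hA).1 w hwE).2
  · intro x y hx hy hxy
    by_contra hadj
    have h1 := hbc x y hxy hadj
    have h2 : cn G {x, y} ⊆ {x, y} ∪ X ∪ Sm.biUnion id ∪ B.biUnion (fun A => A.filter (G.Adj x))
        ∪ B.biUnion (fun A => A.filter (G.Adj y)) := by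
      intro v hv
      simp only [cn, mem_filter, mem_univ, true_and, mem_insert, mem_singleton] at hv
      simp only [mem_union, mem_insert, mem_singleton, mem_biUnion, mem_filter, id]
      rcases hD.cover v with h | ⟨E, hE, hvE⟩
      · exact Or.inl (Or.inl (Or.inl (Or.inr h)))
      · by_cases hEc : Θ < E.card
        · have hEB : E ∈ B := mem_filter.2 ⟨hE, hEc⟩
          obtain ⟨s, rfl | rfl, h | h⟩ := hv
          · exact Or.inl (Or.inl (Or.inl (Or.inl (Or.inl h))))
          · exact Or.inl (Or.inr ⟨E, hEB, hvE, h⟩)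
          · exact Or.inl (Or.inl (Or.inl (Or.inl (Or.inr h))))
          · exact Or.inr ⟨E, hEB, hvE, h⟩
        · exact Or.inl (Or.inl (Or.inr ⟨E, mem_filter.2 ⟨hE, hEc⟩, hvE⟩))
    have h3 := card_le_card h2
    have hBa : B.card ≤ a := (card_le_card (filter_subset _ _)).trans hPa
    have hbu : ∀ z, (∀ A ∈ B, z ∉ A ∪ att A) → (B.biUnion (fun A => A.filter (G.Adj z))).card ≤ a * (a + 1) := by
      intro z hz
      exact (card_biUnion_le_card_mul _ _ _ (hTb z hz)).trans (Nat.mul_le_mul_right _ hBa)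
    have g1 := hbu x hx
    have g2 := hbu y hy
    have g3 := card_union_le ({x, y} ∪ X ∪ Sm.biUnion id ∪ B.biUnion (fun A => A.filter (G.Adj x)))
      (B.biUnion (fun A => A.filter (G.Adj y)))
    have g4 := card_union_le ({x, y} ∪ X ∪ Sm.biUnion id) (B.biUnion (fun A => A.filter (G.Adj x)))
    have g5 := card_union_le ({x, y} ∪ X) (Sm.biUnion id)
    have g6 := card_union_le {x, y} X
    have g7 : ({x, y} : Finset V).card ≤ 2 := card_le_two
    have g8 : a * (a + 1) = a ^ 2 + a := by ring
    omega

theorem struct2 [Fintype V] [Nonempty V] (G : SimpleGraph V) (a m p : ℕ) (ha : 1 ≤ a) (hp : 2 ≤ p)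
    (hα : AlphaLE G a) (hm : 20 * a ^ 3 ≤ m)
    (hcirc : ∀ l, CL G l → l.length + 1 ≤ m)
    (hbc : ∀ x y, x ≠ y → ¬ G.Adj x y → m + 1 ≤ (cn G {x, y}).card)
    (hN : (p - 1) * (m - 1) + 1 ≤ Fintype.card V) :
    ∃ I : Finset V, I.card = p ∧ Ind G I ∧ ∀ l, CL (FI G I) l → False := by
  have hm3 : 3 ≤ m := by
    have : 1 ≤ a ^ 3 := Nat.one_le_pow _ _ ha
    omega
  obtain ⟨X, B, att, f, hBX, hBB, hattX, hsep, hcard3, hcarda, hf, hfN, hT⟩ := struct1 G a m ha hα hm hbc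
  have hBB' : ∀ P ∈ B, ∀ Q ∈ B, P ≠ Q → ∀ u ∈ P, ∀ v ∈ Q, u ≠ v :=
    fun P hP Q hQ h u hu v hv => (hBB P hP Q hQ h u hu v hv).1
  have hfinj : Set.InjOn f B := by
    intro P hP Q hQ h
    by_contra hne
    exact hBB' P hP Q hQ hne _ (hf P hP) _ (hf Q hQ) h
  have hfInd : Ind G (B.image f) := by
    intro u hu v hv
    rw [mem_image] at hu hv
    obtain ⟨P, hP, rfl⟩ := hu
    obtain ⟨Q, hQ, rfl⟩ := hv
    by_cases h : P = Q
    · subst h; exact G.loopless.irrefl _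
    · exact (hBB P hP Q hQ h _ (hf P hP) _ (hf Q hQ)).2
  by_cases hb : p ≤ B.card
  · obtain ⟨B', hB', hB'c⟩ := exists_subset_card_eq hb
    refine ⟨B'.image f, ?_, hfInd.subset (image_subset_image hB'), ?_⟩
    · rw [card_image_of_injOn (hfinj.mono (by exact_mod_cast hB')), hB'c]
    · intro l hl
      refine acyclic_core G a m hα hcirc hbc X B att f hBX hBB' hattX hsep hcard3 hf hfN (fun _ => False)
        (fun x y h => h.elim) (fun x h => h.elim) (fun x h => h.elim) _
        (hfInd.subset (image_subset_image hB')) ?_ l hl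
      intro i hi
      rw [mem_image] at hi
      obtain ⟨P, hP, e⟩ := hi
      exact Or.inl ⟨P, hB' hP, e.symm⟩
  push Not at hb
  have hQadj : ∀ P ∈ B, ∀ u ∈ P ∪ att P, ∀ v ∈ P ∪ att P, u ≠ v →
      ∃ l, PT G u v l ∧ (∀ w, w ∈ l ↔ w ∈ P ∪ att P) ∧ l.length = (P ∪ att P).card := by
    intro P hP u hu v hv huv
    obtain ⟨l, hl, hl'⟩ := hamConn G hα _ (hsep P hP _ (Subset.refl _)) u v hu hv huv
    exact ⟨l, hl, hl', ham_len hl hl'⟩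
  have hQ3 : ∀ P ∈ B, 3 ≤ (P ∪ att P).card := fun P hP => (hcard3 P hP).trans (card_le_card subset_union_left)
  have hQm : ∀ P ∈ B, (P ∪ att P).card + 1 ≤ m := by
    intro P hP
    obtain ⟨u, hu, v, hv, huv⟩ := hα.exists_adj P (hcarda P hP)
    obtain ⟨l, hl, _, hlen⟩ := hQadj P hP u (mem_union_left _ hu) v (mem_union_left _ hv) huv.ne
    rw [← hlen]
    exact hcirc l ⟨by have := hQ3 P hP; omega, u, v, hl, huv.symm⟩
  set T : Finset V := univ.filter (fun x => ∀ P ∈ B, x ∉ P ∪ att P) with hTdef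
  have hTc : ∀ x ∈ T, ∀ y ∈ T, x ≠ y → G.Adj x y := fun x hx y hy h =>
    hT x y (mem_filter.1 hx).2 (mem_filter.1 hy).2 h
  by_cases hτ : ∃ τ ∈ T, ∀ P ∈ B, ∀ u ∈ P ∪ att P, ∀ v ∈ P ∪ att P, G.Adj τ u → G.Adj τ v → u = v
  · obtain ⟨τ, hτT, hτN⟩ := hτ
    have hτT' := (mem_filter.1 hτT).2
    have hTm := clique_card_lt G m hm3 hcirc T hTc
    have hcov : (univ : Finset V) ⊆ B.biUnion (fun P => P ∪ att P) ∪ T := by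
      intro v _
      by_cases hv : v ∈ T
      · exact mem_union_right _ hv
      · refine mem_union_left _ ?_
        rw [hTdef, mem_filter] at hv
        push Not at hv
        obtain ⟨P, hP, h⟩ := hv (mem_univ _)
        exact mem_biUnion.2 ⟨P, hP, h⟩
    have h1 := card_le_card hcov
    rw [card_univ] at h1
    have h2 := card_union_le (B.biUnion (fun P => P ∪ att P)) T
    have h3 := card_biUnion_le_card_mul B (fun P => P ∪ att P) (m - 1) (fun P hP => by
      have := hQm P hP; omega)
    have hbp : B.card = p - 1 := by
      by_contra hne
      have h4 : B.card + 1 ≤ p - 1 := by omega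
      have h5 := Nat.mul_le_mul_right (m - 1) h4
      have h6 : (B.card + 1) * (m - 1) = B.card * (m - 1) + (m - 1) := by ring
      omega
    have hτf : τ ∉ B.image f := by
      intro h
      rw [mem_image] at h
      obtain ⟨P, hP, rfl⟩ := h
      exact hτT' P hP (mem_union_left _ (hf P hP))
    have hτadj : ∀ P ∈ B, ¬ G.Adj (f P) τ := fun P hP h => hτT' P hP (hfN P hP τ h)
    have hInd : Ind G (insert τ (B.image f)) := by
      intro u hu v hv
      rw [mem_insert] at hu hv
      rcases hu with rfl | hu <;> rcases hv with rfl | hv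
      · exact G.loopless.irrefl _
      · obtain ⟨P, hP, rfl⟩ := mem_image.1 hv
        exact fun h => hτadj P hP h.symm
      · obtain ⟨P, hP, rfl⟩ := mem_image.1 hu
        exact hτadj P hP
      · exact hfInd u hu v hv
    refine ⟨insert τ (B.image f), ?_, hInd, ?_⟩
    · rw [card_insert_of_notMem hτf, card_image_of_injOn hfinj]; omega
    · intro l hl
      refine acyclic_core G a m hα hcirc hbc X B att f hBX hBB' hattX hsep hcard3 hf hfN (fun x => x = τ)
        (fun x y h h' => h.trans h'.symm) (fun x h => h ▸ hτT') (fun x h => h ▸ hτN) _ hInd ?_ l hl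
      intro i hi
      rcases mem_insert.1 hi with h | h
      · exact Or.inr h
      · obtain ⟨P, hP, e⟩ := mem_image.1 h
        exact Or.inl ⟨P, hP, e.symm⟩
  · exfalso
    push Not at hτ
    have hg : ∀ τ, ∃ P, τ ∈ T → P ∈ B ∧ ∃ u ∈ P ∪ att P, ∃ v ∈ P ∪ att P, G.Adj τ u ∧ G.Adj τ v ∧ u ≠ v := by
      intro τ
      by_cases h : τ ∈ T
      · obtain ⟨P, hP, h⟩ := hτ τ h
        exact ⟨P, fun _ => ⟨hP, h⟩⟩
      · exact ⟨∅, fun h' => absurd h' h⟩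
    choose g hg using hg
    have hcov : (univ : Finset V) ⊆ B.biUnion (fun P => (P ∪ att P) ∪ T.filter (fun x => g x = P)) := by
      intro v _
      rw [mem_biUnion]
      by_cases hv : v ∈ T
      · exact ⟨g v, (hg v hv).1, mem_union_right _ (mem_filter.2 ⟨hv, rfl⟩)⟩
      · rw [hTdef, mem_filter] at hv
        push Not at hv
        obtain ⟨P, hP, h⟩ := hv (mem_univ _)
        exact ⟨P, hP, mem_union_left _ h⟩
    have hle : ∀ P ∈ B, ((P ∪ att P) ∪ T.filter (fun x => g x = P)).card ≤ m - 1 := by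
      intro P hP
      by_cases hTP : (T.filter (fun x => g x = P)).Nonempty
      · obtain ⟨x, hx, y, hy, l, hl, hlm, hll⟩ := clique_PT G _ hTP (fun x hx y hy h =>
          hTc x (mem_filter.1 hx).1 y (mem_filter.1 hy).1 h)
        rw [mem_filter] at hx hy
        obtain ⟨_, u, hu, v, hv, hxu, hxv, huv⟩ := hg x hx.1
        obtain ⟨_, w, hw, _, _, hyw, _, _⟩ := hg y hy.1
        rw [hx.2] at hu hv
        rw [hy.2] at hw
        obtain ⟨z, hz, hxz, hwz⟩ : ∃ z ∈ P ∪ att P, G.Adj x z ∧ w ≠ z := by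
          by_cases h : w = u
          · exact ⟨v, hv, hxv, h ▸ huv⟩
          · exact ⟨u, hu, hxu, h⟩
        obtain ⟨l2, hl2, hl2m, hl2l⟩ := hQadj P hP w hw z hz hwz
        have hc : PT G x z (l ++ l2) := hl.append hl2 hyw (by
          intro v hv hv'
          rw [hlm, mem_filter] at hv
          rw [hl2m] at hv'
          exact (mem_filter.1 hv.1).2 P hP hv')
        have h3 := hQ3 P hP
        have h4 := hcirc _ ⟨by simp; omega, x, z, hc, hxz.symm⟩
        have h5 := card_union_le (P ∪ att P) (T.filter (fun x => g x = P))
        simp at h4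
        omega
      · rw [not_nonempty_iff_eq_empty] at hTP
        rw [hTP, union_empty]
        have := hQm P hP
        omega
    have h1 := card_le_card hcov
    rw [card_univ] at h1
    have h3 := card_biUnion_le_card_mul B _ (m - 1) hle
    have h4 : B.card * (m - 1) ≤ (p - 1) * (m - 1) := Nat.mul_le_mul_right _ (by omega)
    omega

end

-- K
section
open Classical Finset

variable {V : Type*}

noncomputable def UJ [Fintype V] (G : SimpleGraph V) (I J : Finset V) : Finset V :=
  univ.filter (fun u => ∀ i ∈ I, (u = i ∨ G.Adj i u) → i ∈ J)

theorem UJ_loss [Fintype V] (G : SimpleGraph V) (I J : Finset V) (hI : Ind G I) (hJ : J ⊆ I)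
    (hne : J.Nonempty) (hac : ∀ l, CL (FI G I) l → False) :
    J.card * (UJ G I J).card + 1 ≤ ∑ i ∈ J, (UJ G I (J.erase i)).card + (UJ G I J).card + J.card := by
  set U := UJ G I J with hU
  have hJU : J ⊆ U := by
    intro j hj
    refine mem_filter.2 ⟨mem_univ _, fun i hi h => ?_⟩
    rcases h with rfl | h
    · exact hj
    · exact absurd h (hI i hi j (hJ hj))
  have hUI : ∀ u ∈ U, u ∈ I → u ∈ J := fun u hu hi => (mem_filter.1 hu).2 u hi (Or.inl rfl)
  have h1 := forest_edges (FI G I) U (hne.mono hJU) (fun l h _ => hac l h)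
  have h2 : ∑ v ∈ U, (U.filter ((FI G I).Adj v)).card =
      ∑ v ∈ U \ J, (U.filter ((FI G I).Adj v)).card + ∑ v ∈ J, (U.filter ((FI G I).Adj v)).card :=
    (sum_sdiff hJU).symm
  have h3 : ∑ v ∈ J, (U.filter ((FI G I).Adj v)).card = ∑ v ∈ U \ J, (U.filter ((FI G I).Adj v)).card := by
    have e1 : ∀ v ∈ J, (U.filter ((FI G I).Adj v)) = (U \ J).filter ((FI G I).Adj v) := by
      intro v hv
      ext w
      simp only [mem_filter, mem_sdiff]
      constructor
      · rintro ⟨a, b⟩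
        exact ⟨⟨a, fun h => hI v (hJ hv) w (hJ h) b.1⟩, b⟩
      · rintro ⟨a, b⟩
        exact ⟨a.1, b⟩
    have e2 : ∀ w ∈ U \ J, (U.filter ((FI G I).Adj w)) = J.filter (fun v => (FI G I).Adj v w) := by
      intro w hw
      rw [mem_sdiff] at hw
      ext v
      simp only [mem_filter]
      constructor
      · rintro ⟨a, b⟩
        refine ⟨?_, b.symm⟩
        rcases b.2 with h | h
        · exact absurd (hUI w hw.1 h) hw.2
        · exact hUI v a h
      · rintro ⟨a, b⟩
        exact ⟨hJU a, b.symm⟩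
    rw [sum_congr rfl (fun v hv => congrArg card (e1 v hv)),
      sum_congr rfl (fun v hv => congrArg card (e2 v hv))]
    exact sum_card_bipartiteAbove_eq_sum_card_bipartiteBelow _
  have h4 : ∀ i ∈ J, U.card = (UJ G I (J.erase i)).card + ((U.filter ((FI G I).Adj i)).card + 1) := by
    intro i hi
    have hs : U \ UJ G I (J.erase i) = insert i (U.filter ((FI G I).Adj i)) := by
      ext u
      simp only [mem_sdiff, mem_insert, mem_filter]
      constructor
      · rintro ⟨a, b⟩
        simp only [UJ, mem_filter, mem_univ, true_and] at b
        push Not at b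
        obtain ⟨i', hi', h, h'⟩ := b
        have hi'J := (mem_filter.1 a).2 i' hi' h
        have : i' = i := by
          by_contra hne
          exact h' (mem_erase.2 ⟨hne, hi'J⟩)
        subst this
        rcases h with h | h
        · exact Or.inl h
        · exact Or.inr ⟨a, h, Or.inl hi'⟩
      · rintro (rfl | ⟨a, b⟩)
        · refine ⟨hJU hi, fun h => ?_⟩
          exact notMem_erase u J ((mem_filter.1 h).2 u (hJ hi) (Or.inl rfl))
        · refine ⟨a, fun h => ?_⟩
          exact notMem_erase i J ((mem_filter.1 h).2 i (hJ hi) (Or.inr b.1))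
    have hsub : UJ G I (J.erase i) ⊆ U := by
      intro u hu
      refine mem_filter.2 ⟨mem_univ _, fun i' hi' h => ?_⟩
      exact mem_of_mem_erase ((mem_filter.1 hu).2 i' hi' h)
    have h5 := card_sdiff_add_card_eq_card hsub
    rw [hs, card_insert_of_notMem (by simp)] at h5
    omega
  have h5 : ∑ i ∈ J, U.card = ∑ i ∈ J, ((UJ G I (J.erase i)).card + ((U.filter ((FI G I).Adj i)).card + 1)) :=
    sum_congr rfl h4
  rw [sum_add_distrib, sum_add_distrib, sum_const, sum_const, smul_eq_mul, smul_eq_mul] at h5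
  omega

theorem UJ_step [Fintype V] (G : SimpleGraph V) (I J : Finset V) (hI : Ind G I) (hJ : J ⊆ I)
    (hne : J.Nonempty) (hac : ∀ l, CL (FI G I) l → False) (q s : ℕ)
    (h : q * J.card ≤ (UJ G I J).card + s) :
    ∃ i ∈ J, q * (J.card - 1) ≤ (UJ G I (J.erase i)).card + s := by
  by_contra hcon
  push Not at hcon
  have h1 := UJ_loss G I J hI hJ hne hac
  have h2 : ∑ i ∈ J, ((UJ G I (J.erase i)).card + s + 1) ≤ ∑ i ∈ J, q * (J.card - 1) :=
    sum_le_sum (fun i hi => hcon i hi)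
  rw [sum_add_distrib, sum_add_distrib, sum_const, sum_const, sum_const] at h2
  simp only [smul_eq_mul] at h2
  obtain ⟨j, hj⟩ : ∃ j, J.card = j + 1 := ⟨J.card - 1, by have := hne.card_pos; omega⟩
  rw [hj] at h1 h2 h
  simp only [Nat.add_sub_cancel] at h2
  generalize (UJ G I J).card = u at *
  generalize ∑ i ∈ J, (UJ G I (J.erase i)).card = w at *
  nlinarith

theorem forestBook [Fintype V] (G : SimpleGraph V) (I : Finset V) (t k n q s : ℕ) (hI : Ind G I)
    (hc : I.card = t + k) (hac : ∀ l, CL (FI G I) l → False)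
    (h1 : q * (t + k) ≤ Fintype.card V + s) (h2 : n + s ≤ q * t) : HasBook Gᶜ k n := by
  have key : ∀ j ≤ k, ∃ J ⊆ I, J.card = t + k - j ∧ q * J.card ≤ (UJ G I J).card + s := by
    intro j
    induction j with
    | zero =>
      intro _
      refine ⟨I, Subset.refl _, by omega, ?_⟩
      have : UJ G I I = univ := by
        ext u; simp only [UJ, mem_filter, mem_univ, true_and, iff_true]
        intro i hi _; exact hi
      rw [this, hc, card_univ]; exact h1
    | succ j ih =>
      intro hj
      obtain ⟨J, hJ, hJc, h⟩ := ih (by omega)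
      obtain ⟨i, hi, h'⟩ := UJ_step G I J hI hJ (by rw [← card_pos]; omega) hac q s h
      refine ⟨J.erase i, (erase_subset _ _).trans hJ, ?_, ?_⟩
      · rw [card_erase_of_mem hi]; omega
      · rw [card_erase_of_mem hi]; exact h'
  obtain ⟨J, hJ, hJc, h⟩ := key k le_rfl
  have hJt : J.card = t := by omega
  rw [hJt] at h
  obtain ⟨T, hT, hTc⟩ := exists_subset_card_eq (show n ≤ (UJ G I J).card by omega)
  have hTJ : ∀ v ∈ T, ∀ i ∈ I, (v = i ∨ G.Adj i v) → i ∈ J := fun v hv => (mem_filter.1 (hT hv)).2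
  refine ⟨I \ J, T, ?_, hTc, ?_, ?_, ?_⟩
  · rw [card_sdiff_of_subset hJ]; omega
  · rw [disjoint_left]
    intro u hu hu'
    rw [mem_sdiff] at hu
    exact hu.2 (hTJ u hu' u hu.1 (Or.inl rfl))
  · intro u hu v hv huv
    rw [mem_sdiff] at hu hv
    exact (SimpleGraph.compl_adj _ _ _).2 ⟨huv, hI u hu.1 v hv.1⟩
  · intro u hu v hv
    rw [mem_sdiff] at hu
    refine (SimpleGraph.compl_adj _ _ _).2 ⟨?_, ?_⟩
    · rintro rfl; exact hu.2 (hTJ u hv u hu.1 (Or.inl rfl))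
    · intro h; exact hu.2 (hTJ v hv u hu.1 (Or.inr h))

theorem BC_of_noBook [Fintype V] (G : SimpleGraph V) (k n K : ℕ) (hno : ¬ HasBook Gᶜ k n)
    (hK : K + n ≤ Fintype.card V + 1) : BC G k K := by
  intro S hS hSc
  by_contra hcon
  apply hno
  have h1 : (univ \ cn G S).card = Fintype.card V - (cn G S).card := by
    rw [card_sdiff_of_subset (subset_univ _), card_univ]
  obtain ⟨T, hT, hTc⟩ := exists_subset_card_eq (show n ≤ (univ \ cn G S).card by omega)
  have hTS : ∀ v ∈ T, ∀ s ∈ S, v ≠ s ∧ ¬ G.Adj s v := by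
    intro v hv s hs
    have := (mem_sdiff.1 (hT hv)).2
    simp only [cn, mem_filter, mem_univ, true_and] at this
    push Not at this
    exact this s hs
  refine ⟨S, T, hSc, hTc, ?_, ?_, ?_⟩
  · rw [disjoint_left]
    intro u hu hu'
    exact (hTS u hu' u hu).1 rfl
  · intro u hu v hv huv
    exact (SimpleGraph.compl_adj _ _ _).2 ⟨huv, hS u hu v hv⟩
  · intro u hu v hv
    exact (SimpleGraph.compl_adj _ _ _).2 ⟨(hTS v hv u hu).1.symm, (hTS v hv u hu).2⟩

end

-- M
section
open Classical Finset

theorem upper_main (t k m n q r N : ℕ) (ht : 2 ≤ t) (hk : 3 ≤ k) (hmEven : Even m)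
    (hm : 17280000000 * (t + k) ^ 9 ≤ m) (hr : r < t) (hn : n = t * q + r + 1)
    (hn2 : n ≤ t * (m - 1)) (hq : q + k + 1 ≤ m)
    (hN1 : (t + k - 1) * (m - 1) + 1 ≤ N) (hN2 : n + k * q + k ≤ N) (hN3 : N ≤ (t + k) * m) :
    RamseyProp m k n N := by
  intro G
  by_contra hcon
  push Not at hcon
  obtain ⟨hc, hb⟩ := hcon
  have hno : ¬ ∃ l, CL G l ∧ l.length = m := by
    rintro ⟨l, hl, rfl⟩
    exact hc hl.hasCycleLen
  obtain ⟨p, hp⟩ : ∃ p, p = t + k := ⟨_, rfl⟩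
  have hp5 : 5 ≤ p := by omega
  obtain ⟨a, ha⟩ : ∃ a, a = 330 * p ^ 3 := ⟨_, rfl⟩
  have ha3 : a ^ 3 = 35937000 * p ^ 9 := by rw [ha]; ring
  rw [← hp] at hm
  have hma : 480 * a ^ 3 ≤ m := by rw [ha3]; omega
  have ha1 : 1 ≤ a := by
    rw [ha]; have := Nat.one_le_pow 3 p (by omega); omega
  have hp49 : p ^ 4 ≤ p ^ 9 := Nat.pow_le_pow_right (by omega) (by norm_num)
  have ha13 : a ≤ a ^ 3 := by simpa using Nat.pow_le_pow_right ha1 (show 1 ≤ 3 by norm_num)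
  have ha23 : a ^ 2 ≤ a ^ 3 := Nat.pow_le_pow_right ha1 (show 2 ≤ 3 by norm_num)
  have hpm : p ≤ m := by
    have : p ^ 1 ≤ p ^ 9 := Nat.pow_le_pow_right (by omega) (by norm_num)
    simp only [pow_one] at this
    omega
  obtain ⟨M, rfl⟩ : ∃ M, m = M + 1 := ⟨m - 1, by omega⟩
  simp only [Nat.add_sub_cancel] at hn2 hN1
  have hNc : Fintype.card (Fin N) = N := Fintype.card_fin N
  have hB : BC G k ((k - 1) * (M + 1 - 1) + 2) := by
    refine BC_of_noBook G k n _ hb ?_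
    rw [hNc]
    obtain ⟨k', rfl⟩ : ∃ k', k = k' + 1 := ⟨k - 1, by omega⟩
    simp only [Nat.add_sub_cancel]
    have e : (t + (k' + 1) - 1) * M = t * M + k' * M := by
      rw [← add_assoc, Nat.add_sub_cancel]; ring
    omega
  have hα : AlphaLE G a := by
    rw [ha]
    refine alphaBound G p k (M + 1) _ hp5 (by omega) (by omega) (by rw [hNc, hp]; exact hN3) (by omega) hmEven hB ?_ hno
    obtain ⟨j, rfl⟩ : ∃ j, k = j + 3 := ⟨k - 3, by omega⟩
    have h4 : 4 * ((M + 1) / 4) ≤ M + 1 := Nat.mul_div_le _ _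
    simp only [Nat.add_sub_cancel]
    have e : (j + 3 - 1) = j + 2 := by omega
    rw [e]
    have h5 : (M + 1) / 4 ≤ M := by omega
    nlinarith [Nat.mul_le_mul_left j h5]
  have hcirc := noLong G hα (m := M + 1) (by
    have : (2 * a + 1) * ((3 * a + 4) * a + 1) = 6 * a ^ 3 + 11 * a ^ 2 + 6 * a + 1 := by ring
    omega) (by omega) hno
  have hbc := BC2 G k (M + 1) hk (by omega) hB (by
    rw [hNc]
    simp only [Nat.add_sub_cancel]
    have e : (k + 1) * M ≤ (t + k - 1) * M := Nat.mul_le_mul_right _ (by omega)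
    have e2 : (k + 1) * M = k * M + M := by ring
    omega) hcirc
  have : Nonempty (Fin N) := ⟨⟨0, by omega⟩⟩
  obtain ⟨I, hIc, hI, hac⟩ := struct2 G a (M + 1) p ha1 (by omega) hα (by omega) hcirc hbc
    (by rw [hNc, hp]; exact hN1)
  apply hb
  refine forestBook G I t k n (q + 1) (t - r - 1) hI (by omega) hac ?_ ?_
  · rw [hNc]
    have e : (q + 1) * (t + k) = t * q + k * q + t + k := by ring
    omega
  · have e : (q + 1) * t = t * q + t := by ring
    omega

end

-- L
section
open Classical Finset

theorem chain_all {V : Type*} {R : V → V → Prop} {P : V → Prop} (l : List V) (h : l.IsChain R)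
    (hP : ∀ u ∈ l, ∀ v ∈ l, R u v → (P u ↔ P v)) : ∀ u ∈ l, ∀ v ∈ l, P u → P v := by
  have key : ∀ (l : List V) (x : V), (x :: l).IsChain R →
      (∀ u ∈ x :: l, ∀ v ∈ x :: l, R u v → (P u ↔ P v)) → ∀ v ∈ x :: l, (P x ↔ P v) := by
    intro l
    induction l with
    | nil => intro x _ _ v hv; simp at hv; subst hv; rfl
    | cons y l ih =>
      intro x h hP v hv
      have h1 := List.isChain_cons_cons.1 h
      rcases List.mem_cons.1 hv with rfl | hv
      · rfl
      · rw [hP x (by simp) y (by simp) h1.1]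
        exact ih y h1.2 (fun u hu v hv => hP u (List.mem_cons_of_mem _ hu) v (List.mem_cons_of_mem _ hv)) v hv
  match l, h, hP with
  | [], _, _ => simp
  | x :: l, h, hP =>
    intro u hu v hv hPu
    exact (key l x h hP v hv).1 ((key l x h hP u hu).2 hPu)

theorem not_ramsey {V : Type*} [Fintype V] (G : SimpleGraph V) (m k n N : ℕ)
    (hno : ∀ l, CL G l → l.length ≠ m)
    (hbk : ∀ S, Ind G S → S.card = k → Fintype.card V < n + (cn G S).card)
    (hN : N ≤ Fintype.card V) : ¬ RamseyProp m k n N := by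
  intro h
  obtain ⟨e⟩ : Nonempty (Fin N ↪ V) := Function.Embedding.nonempty_of_card_le (by simpa using hN)
  rcases h (G.comap e) with hc | hb
  · obtain ⟨l, ⟨h3, x, y, ⟨p1, p2, p3, p4⟩, hxy⟩, hl⟩ := hc.exists_CL
    refine hno (l.map e) ⟨by simpa using h3, e x, e y, ⟨?_, ?_, ?_, ?_⟩, hxy⟩ (by simpa using hl)
    · exact p1.map e.injective
    · rw [List.isChain_map]; exact p2
    · simp [p3]
    · simp [p4]
  · obtain ⟨S, T, hS, hT, hd, h1, h2⟩ := hb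
    have hI : Ind G (S.map e) := by
      intro u hu v hv hadj
      rw [mem_map] at hu hv
      obtain ⟨u, hu, rfl⟩ := hu
      obtain ⟨v, hv, rfl⟩ := hv
      have hne : u ≠ v := by rintro rfl; exact G.loopless.irrefl _ hadj
      exact ((SimpleGraph.compl_adj _ _ _).1 (h1 u hu v hv hne)).2 hadj
    have h3 := hbk _ hI (by simpa using hS)
    have h4 : Disjoint (T.map e) (cn G (S.map e)) := by
      rw [disjoint_left]
      intro v hv hv'
      rw [mem_map] at hv
      obtain ⟨v, hv, rfl⟩ := hv
      simp only [cn, mem_filter, mem_univ, true_and] at hv'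
      obtain ⟨s, hs, hv'⟩ := hv'
      rw [mem_map] at hs
      obtain ⟨s, hs, rfl⟩ := hs
      have h5 := (SimpleGraph.compl_adj _ _ _).1 (h2 s hs v hv)
      rcases hv' with h | h
      · exact h5.1 (e.injective h).symm
      · exact h5.2 h
    have h5 := card_le_univ (T.map e ∪ cn G (S.map e))
    rw [card_union_of_disjoint h4, card_map, hT] at h5
    omega

def G1 (b c : ℕ) : SimpleGraph (Fin b × Fin c) where
  Adj x y := x.1 = y.1 ∧ x ≠ y
  symm := ⟨fun _ _ h => ⟨h.1.symm, h.2.symm⟩⟩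
  loopless := ⟨fun _ h => h.2 rfl⟩

theorem lower1 (t k m n N : ℕ) (ht : 2 ≤ t) (hk : 3 ≤ k) (hm : 3 ≤ m)
    (hn1 : (t - 1) * (m - 1) < n) (hN : N ≤ (t + k - 1) * (m - 1)) : ¬ RamseyProp m k n N := by
  refine not_ramsey (G1 (t + k - 1) (m - 1)) m k n N ?_ ?_ (by simpa using hN)
  · intro l hl hlm
    obtain ⟨x, hx⟩ : ∃ x, x ∈ l := List.exists_mem_of_ne_nil _ (by rintro rfl; simp at hlm; omega)
    have h1 : ∀ v ∈ l, v.1 = x.1 := fun v hv =>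
      chain_all (P := fun v => v.1 = x.1) l hl.chain (fun u _ v _ h => by rw [h.1]) x hx v hv rfl
    have h2 := nodup_length_le hl.nodup (U := ({x.1} : Finset _) ×ˢ univ) (fun v hv =>
      mem_product.2 ⟨mem_singleton.2 (h1 v hv), mem_univ _⟩)
    simp at h2
    omega
  · intro S hS hSc
    have h1 : (S.image Prod.fst) ×ˢ univ ⊆ cn (G1 (t + k - 1) (m - 1)) S := by
      intro v hv
      rw [mem_product, mem_image] at hv
      obtain ⟨⟨s, hs, e⟩, _⟩ := hv
      simp only [cn, mem_filter, mem_univ, true_and]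
      refine ⟨s, hs, ?_⟩
      by_cases h : v = s
      · exact Or.inl h
      · exact Or.inr ⟨e, Ne.symm h⟩
    have h2 : (S.image Prod.fst).card = k := by
      rw [card_image_of_injOn, hSc]
      intro u hu v hv h
      by_contra hne
      exact hS u hu v hv ⟨h, hne⟩
    have h3 := card_le_card h1
    rw [card_product, h2] at h3
    simp only [card_univ, Fintype.card_fin, Fintype.card_prod] at h3 ⊢
    have e : t + k - 1 = (t - 1) + k := by omega
    have e2 : (t + k - 1) * (m - 1) = (t - 1) * (m - 1) + k * (m - 1) := by rw [e, add_mul]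
    omega

def G2A (b q c a : ℕ) : (Fin b × Fin (q + 1)) ⊕ Fin c → (Fin b × Fin (q + 1)) ⊕ Fin c → Prop
  | .inl x, .inl y => x.1 = y.1 ∧ x ≠ y
  | .inl x, .inr _ => x.2 = 0 ∧ x.1.val < a
  | .inr _, .inl x => x.2 = 0 ∧ x.1.val < a
  | .inr x, .inr y => x ≠ y

def G2 (b q c a : ℕ) : SimpleGraph ((Fin b × Fin (q + 1)) ⊕ Fin c) where
  Adj := G2A b q c a
  symm := ⟨fun x y h => by
    rcases x with x | x <;> rcases y with y | y
    · exact ⟨h.1.symm, h.2.symm⟩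
    · exact h
    · exact h
    · exact Ne.symm h⟩
  loopless := ⟨fun x h => by
    rcases x with x | x
    · exact h.2 rfl
    · exact h rfl⟩

theorem card_lt_filter (b a : ℕ) (ha : a ≤ b) : (univ.filter (fun i : Fin b => i.val < a)).card = a := by
  rw [Fin.card_filter_val_lt]; omega

theorem G2_cycle (b q c a m : ℕ) (hab : a ≤ b) (h1 : q + 1 < m) (h2 : c + a < m) (l) (hl : CL (G2 b q c a) l) :
    l.length ≠ m := by
  suffices hs : l.length < m by omega
  by_cases hx : ∃ i x, x ≠ 0 ∧ Sum.inl (i, x) ∈ l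
  · obtain ⟨i, x, hx0, hxl⟩ := hx
    have key : ∀ L : List ((Fin b × Fin (q + 1)) ⊕ Fin c), L.IsChain (G2 b q c a).Adj →
        Sum.inl (i, 0) ∉ L → Sum.inl (i, x) ∈ L → ∀ v ∈ L, ∃ z, v = Sum.inl (i, z) := by
      intro L hL h0 hxL v hv
      refine chain_all (P := fun v => ∃ z, v = Sum.inl (i, z)) L hL ?_ _ hxL v hv ⟨x, rfl⟩
      intro u hu w hw hadj
      rcases u with ⟨u, u'⟩ | u <;> rcases w with ⟨w, w'⟩ | w
      · have h := hadj.1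
        simp only at h
        subst h
        constructor
        · rintro ⟨z, e⟩
          simp at e
          exact ⟨w', by rw [e.1]⟩
        · rintro ⟨z, e⟩
          simp at e
          exact ⟨u', by rw [e.1]⟩
      · constructor
        · rintro ⟨z, e⟩
          have h := hadj.1
          simp at e h
          exact absurd (by rw [← e.1, ← h]; exact hu) h0
        · rintro ⟨z, e⟩; simp at e
      · constructor
        · rintro ⟨z, e⟩; simp at e
        · rintro ⟨z, e⟩
          have h := hadj.1
          simp at e h
          exact absurd (by rw [← e.1, ← h]; exact hw) h0
      · constructor <;> rintro ⟨z, e⟩ <;> simp at e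
    have hall : ∀ v ∈ l, ∃ z, v = Sum.inl (i, z) := by
      by_cases h0 : Sum.inl (i, 0) ∈ l
      · obtain ⟨A, B, rfl⟩ := List.append_of_mem h0
        have hl' := CL.rotate hl
        rw [List.cons_append] at hl'
        have hnd := List.nodup_cons.1 hl'.nodup
        have hmem : ∀ v, v ∈ A ++ Sum.inl (i, 0) :: B → v = Sum.inl (i, 0) ∨ v ∈ B ++ A := by
          intro v hv
          simp only [List.mem_append, List.mem_cons] at hv ⊢
          tauto
        have hxm : Sum.inl (i, x) ∈ B ++ A := by
          rcases hmem _ hxl with h | h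
          · simp at h; exact absurd h hx0
          · exact h
        intro v hv
        rcases hmem v hv with rfl | h
        · exact ⟨0, rfl⟩
        · exact key _ (List.IsChain.of_cons hl'.chain) hnd.1 hxm v h
      · exact key l hl.chain h0 hxl
    have h3 := nodup_length_le hl.nodup (U := univ.image (fun z => Sum.inl (i, z))) (fun v hv => by
      obtain ⟨z, rfl⟩ := hall v hv
      simp)
    have h4 := card_image_le (s := (univ : Finset (Fin (q + 1))))
      (f := fun z => (Sum.inl (i, z) : (Fin b × Fin (q + 1)) ⊕ Fin c))
    simp only [card_univ, Fintype.card_fin] at h4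
    omega
  · push Not at hx
    set C : Finset ((Fin b × Fin (q + 1)) ⊕ Fin c) :=
      univ.image Sum.inr ∪ (univ.filter (fun i : Fin b => i.val < a)).image (fun i => Sum.inl (i, 0)) with hC
    have hmC : ∀ i, Sum.inr i ∈ C := fun i => by simp [hC]
    have hmC' : ∀ i : Fin b, i.val < a → Sum.inl (i, 0) ∈ C := fun i hi => by simp [hC, hi]
    have hadjC : ∀ u ∈ l, ∀ v ∈ l, (G2 b q c a).Adj u v → u ∈ C ∧ v ∈ C := by
      intro u hu w hw hadj
      rcases u with ⟨u, u'⟩ | u <;> rcases w with ⟨w, w'⟩ | w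
      · have e1 : u' = 0 := by
          by_contra h; exact hx u u' h hu
        have e2 : w' = 0 := by
          by_contra h; exact hx w w' h hw
        have h3 := hadj.1
        have h4 := hadj.2
        simp only at h3
        exact absurd (by rw [h3, e1, e2]) h4
      · obtain ⟨h3, h4⟩ := hadj
        simp only at h3 h4
        subst h3
        exact ⟨hmC' u h4, hmC w⟩
      · obtain ⟨h3, h4⟩ := hadj
        simp only at h3 h4
        subst h3
        exact ⟨hmC u, hmC' w h4⟩
      · exact ⟨hmC u, hmC w⟩
    have hall : ∀ v ∈ l, v ∈ C := by
      match l, hl, hadjC with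
      | [], hl, _ => simp
      | [x], hl, _ => simp [CL] at hl
      | x :: y :: l, hl, hadjC =>
        have h3 := (List.isChain_cons_cons.1 hl.chain).1
        have h4 := (hadjC x (by simp) y (by simp) h3).1
        intro v hv
        refine chain_all (P := fun v => v ∈ C) _ hl.chain ?_ x (by simp) v hv h4
        intro u hu w hw hadj
        have := hadjC u hu w hw hadj
        exact ⟨fun _ => this.2, fun _ => this.1⟩
    have h3 := nodup_length_le hl.nodup hall
    have h5 : (univ.image Sum.inr : Finset ((Fin b × Fin (q + 1)) ⊕ Fin c)).card ≤ c := by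
      refine card_image_le.trans ?_
      simp
    have h6 : ((univ.filter (fun i : Fin b => i.val < a)).image
        (fun i => (Sum.inl (i, 0) : (Fin b × Fin (q + 1)) ⊕ Fin c))).card ≤ a := by
      refine card_image_le.trans ?_
      rw [card_lt_filter b a hab]
    have h7 : C.card ≤ c + a := by
      rw [hC]
      exact (card_union_le _ _).trans (Nat.add_le_add (by convert h5) (by convert h6))
    omega

theorem G2_cn (b q c a k : ℕ) (hk : 1 ≤ k) (hab : a ≤ b) (hca : c + a = q + k) (S)
    (hS : Ind (G2 b q c a) S) (hSc : S.card = k) :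
    k * (q + 1) ≤ (cn (G2 b q c a) S).card := by
  set L := S.toLeft with hL
  set R := S.toRight with hR
  have hLR : L.card + R.card = k := by rw [← hSc]; exact card_toLeft_add_card_toRight
  have hR1 : R.card ≤ 1 := by
    rw [card_le_one]
    intro x hx y hy
    by_contra hne
    rw [hR, mem_toRight] at hx hy
    exact hS _ hx _ hy hne
  set F := L.image Prod.fst with hF
  have hFc : F.card = L.card := by
    rw [hF, card_image_of_injOn]
    intro u hu v hv h
    by_contra hne
    exact hS (Sum.inl u) (by simpa [hL] using hu) (Sum.inl v) (by simpa [hL] using hv) ⟨h, hne⟩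
  have hsub1 : (F ×ˢ (univ : Finset (Fin (q + 1)))).map Function.Embedding.inl ⊆ cn (G2 b q c a) S := by
    intro v hv
    rw [mem_map] at hv
    obtain ⟨v, hv, rfl⟩ := hv
    rw [mem_product, hF, mem_image] at hv
    obtain ⟨⟨s, hs, e⟩, _⟩ := hv
    simp only [cn, mem_filter, mem_univ, true_and]
    refine ⟨Sum.inl s, by simpa [hL] using hs, ?_⟩
    by_cases h : v = s
    · left; rw [h]; rfl
    · exact Or.inr ⟨e, Ne.symm h⟩
  have hcard1 : ((F ×ˢ (univ : Finset (Fin (q + 1)))).map (Function.Embedding.inl (β := Fin c))).card = L.card * (q + 1) := by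
    rw [card_map, card_product, hFc]; simp
  rcases Nat.lt_or_ge R.card 1 with h | h
  · have := card_le_card hsub1
    rw [hcard1] at this
    have e : L.card = k := by omega
    rwa [e] at this
  · obtain ⟨r, hr⟩ := card_pos.1 h
    rw [hR, mem_toRight] at hr
    set Z := (univ.filter (fun i : Fin b => i.val < a)) \ F with hZ
    have hZc : a ≤ Z.card + L.card := by
      have : (univ.filter (fun i : Fin b => i.val < a)).card - F.card ≤ Z.card := by
        rw [hZ]; convert le_card_sdiff F (univ.filter (fun i : Fin b => i.val < a))
      rw [card_lt_filter b a hab, hFc] at this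
      omega
    have hsub : ((F ×ˢ (univ : Finset (Fin (q + 1)))) ∪ (Z ×ˢ {0})).disjSum (univ : Finset (Fin c)) ⊆ cn (G2 b q c a) S := by
      intro v hv
      rcases v with v | v
      · rw [inl_mem_disjSum, mem_union] at hv
        rcases hv with hv | hv
        · exact hsub1 (mem_map.2 ⟨v, hv, rfl⟩)
        · rw [mem_product, hZ, mem_sdiff, mem_filter, mem_singleton] at hv
          simp only [cn, mem_filter, mem_univ, true_and]
          exact ⟨_, hr, Or.inr ⟨hv.2, hv.1.1.2⟩⟩
      · simp only [cn, mem_filter, mem_univ, true_and]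
        refine ⟨_, hr, ?_⟩
        by_cases h : v = r
        · left; rw [h]
        · exact Or.inr (Ne.symm h)
    have h3 := card_le_card hsub
    have hd : Disjoint (F ×ˢ (univ : Finset (Fin (q + 1)))) (Z ×ˢ ({0} : Finset (Fin (q + 1)))) := by
      rw [disjoint_left]
      intro v hv hv'
      rw [mem_product] at hv hv'
      exact (mem_sdiff.1 hv'.1).2 hv.1
    rw [card_disjSum, card_union_of_disjoint hd, card_product, card_product, hFc] at h3
    simp only [card_univ, Fintype.card_fin, card_singleton, mul_one] at h3
    have e : k * (q + 1) = L.card * (q + 1) + (q + 1) := by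
      have : k = L.card + 1 := by omega
      rw [this]; ring
    omega

theorem lower2 (t k m n q r N : ℕ) (hk : 3 ≤ k) (hr : r < t) (hn : n = t * q + r + 1)
    (hqt : t ≤ q) (hq : q + k + 1 ≤ m) (hN : N < n + k * q + k) : ¬ RamseyProp m k n N := by
  have hcV : Fintype.card ((Fin (t + k - 1) × Fin (q + 1)) ⊕ Fin (q + 1 + r - t)) + 1 = n + k * q + k := by
    simp only [Fintype.card_sum, Fintype.card_prod, Fintype.card_fin]
    obtain ⟨z, hz⟩ : ∃ z, q + 1 + r - t = z ∧ z + t = q + 1 + r := ⟨_, rfl, by omega⟩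
    obtain ⟨w, hw⟩ : ∃ w, t + k - 1 = w ∧ w + 1 = t + k := ⟨_, rfl, by omega⟩
    rw [hz.1, hw.1]
    have e : (w + 1) * (q + 1) = (t + k) * (q + 1) := by rw [hw.2]
    have e1 : (w + 1) * (q + 1) = w * (q + 1) + (q + 1) := by ring
    have e2 : (t + k) * (q + 1) = t * q + k * q + t + k := by ring
    omega
  refine not_ramsey (G2 (t + k - 1) q (q + 1 + r - t) (t + k - 1 - r)) m k n N ?_ ?_ (by omega)
  · intro l hl
    exact G2_cycle _ _ _ _ m (by omega) (by omega) (by omega) l hl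
  · intro S hS hSc
    have := G2_cn _ _ _ _ k (by omega) (by omega) (by omega) S hS hSc
    have e : k * (q + 1) = k * q + k := by ring
    omega

end

theorem stmt0 (t k m n : ℕ) (ht : 2 ≤ t) (hk : 3 ≤ k) (hmEven : Even m)
    (hm : 17280000000 * (t + k) ^ 9 ≤ m)
    (hn1 : (t - 1) * (m - 1) ≤ n - 1) (hn2 : n - 1 < t * (m - 1))
    (hcase : (n - 1) / t < m - k) :
    IsLeast {N | RamseyProp m k n N}
      (max ((t + k - 1) * (m - 1) + 1) (n + k * ((n - 1) / t) + k)) := by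
  obtain ⟨q, hq⟩ : ∃ q, q = (n - 1) / t := ⟨_, rfl⟩
  obtain ⟨r, hr⟩ : ∃ r, r = (n - 1) % t := ⟨_, rfl⟩
  have hrt : r < t := by rw [hr]; exact Nat.mod_lt _ (by omega)
  have hdiv : t * q + r = n - 1 := by rw [hq, hr]; exact Nat.div_add_mod _ _
  rw [← hq] at hcase ⊢
  have hpp : (t + k) ^ 2 ≤ (t + k) ^ 9 := Nat.pow_le_pow_right (by omega) (by norm_num)
  have hp2 : (t + k) ^ 2 = t * t + 2 * (t * k) + k * k := by ring
  have htt : t ≤ t * t := Nat.le_mul_self t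
  have hkk : k ≤ k * k := Nat.le_mul_self k
  obtain ⟨M, rfl⟩ : ∃ M, m = M + 1 := ⟨m - 1, by omega⟩
  simp only [Nat.add_sub_cancel] at hn1 hn2 ⊢
  have hM1 : 1 * M ≤ (t - 1) * M := Nat.mul_le_mul_right _ (by omega)
  have hn : n = t * q + r + 1 := by omega
  have hqt : t ≤ q := by
    by_contra hcon
    have h1 : t * q ≤ t * t := Nat.mul_le_mul_left _ (by omega)
    omega
  constructor
  · refine upper_main t k (M + 1) n q r _ ht hk hmEven hm hrt hn (by simp only [Nat.add_sub_cancel]; omega)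
      (by omega) (by simp only [Nat.add_sub_cancel]; exact le_max_left _ _) (le_max_right _ _) ?_
    apply max_le
    · have h1 : (t + k - 1) * M ≤ (t + k) * M := Nat.mul_le_mul_right _ (by omega)
      have h2 : (t + k) * (M + 1) = (t + k) * M + (t + k) := by ring
      omega
    · have h1 : k * q ≤ k * M := Nat.mul_le_mul_left _ (by omega)
      have h2 : (t + k) * (M + 1) = t * M + k * M + t + k := by ring
      omega
  · intro N hN
    by_contra hcon
    push Not at hcon
    rcases lt_max_iff.1 hcon with h | h
    · exact lower1 t k (M + 1) n N ht hk (by omega) (by simp only [Nat.add_sub_cancel]; omega)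
        (by simp only [Nat.add_sub_cancel]; omega) hN
    · exact lower2 t k (M + 1) n q r N hk hrt hn hqt (by omega) h hN
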